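/- Let l ≥ 2. Let Φ⁺ ⊂ ℕ^l be the set consisting of: the long roots α_1 and α_1 + 2(α_2 + ⋯ + α_m) for 2 ≤ m ≤ l; the short roots α_i + ⋯ + α_j for 2 ≤ i ≤ j ≤ l; the short roots α_1 + α_2 + ⋯ + α_b for 2 ≤ b ≤ l; and the short roots α_1 + 2(α_2 + ⋯ + α_a) + α_{a+1} + ⋯ + α_b for 2 ≤ a < b ≤ l, where α_s denotes the s-th standard basis vector of ℕ^l (this is the set of the l² positive roots of type C_l in the paper's labeling, with α_1 the long simple root). Then in ℤ[[q, y_1, …, y_l]]: ∏_{c ∈ Φ⁺} ∏_{n≥1} (1 − q^n y_1^{c_1} ⋯ y_l^{c_l})^{−1} = ∑ over all l-tuples (r_1, …, r_l) of descending sequences of q^{E} · ( ∏_{i=1}^{l} y_i^{|r_i|} ) · ∏_{i=1}^{l} ∏_{j≥1} (q;q)_{r_i^{(j)} − r_i^{(j+1)}}^{−1}, where E = ∑_{i=1}^{l} ∑_{t≥1} (r_i^{(t)})² − ∑_{t≥1} r_1^{(t)} ( r_2^{(2t−1)} + r_2^{(2t)} ) − ∑_{i=3}^{l} ∑_{t≥1}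 r_{i−1}^{(t)} r_i^{(t)}; here E is a nonnegative integer. -/

import Mathlib

open MvPowerSeries

/-- The product topology (coefficientwise convergence) on multivariate formal power series. -/
noncomputable instance (σ R : Type*) [TopologicalSpace R] :
    TopologicalSpace (MvPowerSeries σ R) :=
  inferInstanceAs (TopologicalSpace ((σ →₀ ℕ) → R))

/-- `r : ℕ → ℕ` is a descending sequence (indexed so that `r t = r^{(t+1)}`):
nonincreasing and eventually zero. -/
def IsDescending (r : ℕ → ℕ) : Prop :=
  Antitone r ∧ ∃ N, ∀ t ≥ N, r t = 0

/-- The variable `q` in `ℤ[[q, y₁, …, y_l]]`, realized as `MvPowerSeries (Fin (l+1)) ℤ`. -/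
noncomputable def Q (l : ℕ) : MvPowerSeries (Fin (l + 1)) ℤ := X 0

/-- The variable `yᵢ` (`1 ≤ i ≤ l`) in `ℤ[[q, y₁, …, y_l]]`. -/
noncomputable def Y (l : ℕ) (i : ℕ) : MvPowerSeries (Fin (l + 1)) ℤ :=
  if h : i < l + 1 then X ⟨i, h⟩ else 1

/-- `(q;q)_m = ∏_{u=1}^m (1 - qᵘ)`. -/
noncomputable def qPoch (l : ℕ) (m : ℕ) : MvPowerSeries (Fin (l + 1)) ℤ :=
  ∏ u ∈ Finset.range m, (1 - Q l ^ (u + 1))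

/-! ### `q`-series over a ring with an invertible base `q` -/

namespace QSeries

open Finset

/-- A base `q` for `q`-series: a unit such that all `1 - q ^ (n + 1)` are units. -/
class QBase (R : Type*) [CommRing R] where
  q : Rˣ
  isUnit_one_sub : ∀ n : ℕ, IsUnit (1 - (q : R) ^ (n + 1))

variable {R : Type*} [CommRing R] [QBase R]

/-- Integer powers of the base. -/
def qz (n : ℤ) : R := ((QBase.q ^ n : Rˣ) : R)

theorem qz_add (m n : ℤ) : (qz (m + n) : R) = qz m * qz n := by
  simp [qz, zpow_add]

@[simp] theorem qz_zero : (qz 0 : R) = 1 := by simp [qz]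

theorem qz_natCast (n : ℕ) : (qz (n : ℤ) : R) = (QBase.q : Rˣ) ^ n := by
  simp [qz]

theorem qz_pow (m : ℤ) (n : ℕ) : (qz m : R) ^ n = qz (m * n) := by
  simp [qz, zpow_mul]

/-- The finite product `(q;q)_n`. -/
def qf (n : ℕ) : R := ∏ i ∈ range n, (1 - qz ((i : ℤ) + 1))

theorem qf_succ (n : ℕ) : (qf (n + 1) : R) = qf n * (1 - qz ((n : ℤ) + 1)) := by
  simp [qf, prod_range_succ]

@[simp] theorem qf_zero : (qf 0 : R) = 1 := by simp [qf]

theorem isUnit_one_sub_qz (n : ℕ) : IsUnit (1 - qz ((n : ℤ) + 1) : R) := by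
  have := QBase.isUnit_one_sub (R := R) n
  rwa [← qz_natCast, Nat.cast_succ] at this

theorem isUnit_qf (n : ℕ) : IsUnit (qf n : R) := by
  induction n with
  | zero => simp
  | succ n ih => rw [qf_succ]; exact ih.mul (isUnit_one_sub_qz n)

/-- The inverse of `(q;q)_n`. -/
noncomputable def iq (n : ℕ) : R := Ring.inverse (qf n)

theorem qf_mul_iq (n : ℕ) : (qf n : R) * iq n = 1 :=
  Ring.mul_inverse_cancel _ (isUnit_qf n)

@[simp] theorem iq_zero : (iq 0 : R) = 1 := by simp [iq]

theorem iq_eq_succ (n : ℕ) : (iq n : R) = (1 - qz ((n : ℤ) + 1)) * iq (n + 1) := by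
  have h1 := qf_mul_iq (R := R) n
  have h2 := qf_mul_iq (R := R) (n + 1)
  rw [qf_succ] at h2
  linear_combination ((1 - qz ((n : ℤ) + 1)) * iq (n + 1)) * h1 - iq n * h2

/-- `1 / (q;q)_{a - b}`, read as `0` when `a < b`. -/
noncomputable def iz (a b : ℕ) : R := if b ≤ a then iq (a - b) else 0

theorem iz_of_le {a b : ℕ} (h : b ≤ a) : (iz a b : R) = iq (a - b) := if_pos h

theorem iz_of_lt {a b : ℕ} (h : a < b) : (iz a b : R) = 0 := if_neg (by omega)

@[simp] theorem iz_zero (a : ℕ) : (iz a 0 : R) = iq a := by simp [iz]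

@[simp] theorem iz_self (a : ℕ) : (iz a a : R) = 1 := by simp [iz]

theorem iz_add (a b : ℕ) : (iz (a + b) a : R) = iq b := by simp [iz]

theorem qf_mul_iz {a b : ℕ} (h : b ≤ a) : (qf (a - b) : R) * iz a b = 1 := by
  rw [iz_of_le h, qf_mul_iq]

/-- The triangular numbers `k (k - 1) / 2`. -/
def tri (k : ℕ) : ℤ := (k.choose 2 : ℕ)

theorem two_mul_tri (k : ℕ) : 2 * tri k = k * (k - 1) := by
  induction k with
  | zero => simp [tri]
  | succ k ih =>
    simp only [tri, Nat.choose_succ_succ' k 1, Nat.choose_one_right] at ih ⊢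
    push_cast at ih ⊢
    linarith

@[simp] theorem tri_zero : tri 0 = 0 := by simp [tri]

theorem tri_succ (k : ℕ) : tri (k + 1) = tri k + k := by
  have := two_mul_tri k
  have := two_mul_tri (k + 1)
  push_cast at this
  linarith

/-- The `q`-shifted factorial `(x;q)_n`. -/
def pc (x : R) (n : ℕ) : R := ∏ i ∈ range n, (1 - x * qz i)

@[simp] theorem pc_zero (x : R) : pc x 0 = 1 := by simp [pc]

@[simp] theorem zero_pc (n : ℕ) : pc (0 : R) n = 1 := by simp [pc]

theorem pc_succ (x : R) (n : ℕ) : pc x (n + 1) = pc x n * (1 - x * qz n) := by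
  simp [pc, prod_range_succ]

theorem pc_add (x : R) (m n : ℕ) : pc x (m + n) = pc x m * pc (x * qz m) n := by
  simp only [pc, prod_range_add]
  congr 1
  refine prod_congr rfl fun i _ => ?_
  rw [Nat.cast_add, qz_add, mul_assoc]

theorem qf_add (m n : ℕ) : (qf (m + n) : R) = qf m * pc (qz (m + 1)) n := by
  simp only [qf, pc, prod_range_add]
  congr 1
  refine prod_congr rfl fun i _ => ?_
  rw [← qz_add]
  congr 2
  push_cast
  ring

theorem qf_add_mul_iq (m n : ℕ) : (qf (m + n) : R) * iq m = pc (qz (m + 1)) n := by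
  rw [qf_add]
  linear_combination pc (qz (m + 1)) n * qf_mul_iq (R := R) m

/-- The Gaussian binomial coefficient. -/
noncomputable def gb (n k : ℕ) : R := qf n * iq k * iz n k

@[simp] theorem gb_zero (n : ℕ) : (gb n 0 : R) = 1 := by simp [gb, qf_mul_iq]

theorem gb_of_lt {n k : ℕ} (h : n < k) : (gb n k : R) = 0 := by simp [gb, iz_of_lt h]

theorem gb_succ_succ (n k : ℕ) :
    (gb (n + 1) (k + 1) : R) = gb n (k + 1) + qz (n - k) * gb n k := by
  rcases lt_trichotomy n k with h | rfl | h
  · simp [gb_of_lt h, gb_of_lt (show n < k + 1 by omega),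
      gb_of_lt (show n + 1 < k + 1 by omega)]
  · simp [gb, iz_of_lt, qf_mul_iq]
  · obtain ⟨m, rfl⟩ := Nat.exists_eq_add_of_lt h
    have e1 : (k + m + 1 : ℕ) - (k + 1) = m := by omega
    have e2 : (k + m + 1 : ℕ) - k = m + 1 := by omega
    have e3 : (k + m + 1 + 1 : ℕ) - (k + 1) = m + 1 := by omega
    simp only [gb, iz_of_le (show k ≤ k + m + 1 by omega),
      iz_of_le (show k + 1 ≤ k + m + 1 by omega),
      iz_of_le (show k + 1 ≤ k + m + 1 + 1 by omega), e1, e2, e3, qf_succ (k + m + 1),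
      iq_eq_succ m, iq_eq_succ k]
    have h1 : (qz (((k + m + 1 : ℕ) : ℤ) + 1) : R) = qz (m + 1) * qz (k + 1) := by
      rw [← qz_add]; congr 1; push_cast; ring
    have h2 : (((k + m + 1 : ℕ) : ℤ) - k) = m + 1 := by push_cast; ring
    rw [h1, h2]
    ring

/-- The `q`-binomial theorem. -/
theorem sum_gb (x : R) (n N : ℕ) (hN : n < N) :
    ∑ k ∈ range N, gb n k * ((-x) ^ k * qz (tri k)) = pc x n := by
  induction n generalizing N with
  | zero =>
    obtain ⟨N, rfl⟩ := Nat.exists_eq_add_of_lt hN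
    rw [zero_add, sum_range_succ']
    simp [gb_of_lt]
  | succ n ih =>
    obtain ⟨N, rfl⟩ := Nat.exists_eq_add_of_lt hN
    rw [pc_succ, ← ih (n + 1 + N) (by omega), sum_range_succ']
    have e1 := ih (n + 1 + N + 1) (by omega)
    have e2 := ih (n + 1 + N) (by omega)
    rw [sum_range_succ'] at e1
    simp only [gb_succ_succ, add_mul, sum_add_distrib, gb_zero, pow_zero, tri_zero, qz_zero] at e1 ⊢
    rw [add_right_comm, e1, e2, mul_sub, mul_one, sub_eq_add_neg]
    congr 1
    rw [← e2, sum_mul, ← sum_neg_distrib]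
    refine sum_congr rfl fun k _ => ?_
    have : (qz (tri (k + 1)) : R) * qz (n - k) = qz (tri k) * qz n := by
      rw [← qz_add, ← qz_add, tri_succ]; congr 1; ring
    linear_combination gb n k * (-x) ^ (k + 1) * this

/-- The truncated exponential series `∑ (-v)^k q^{k(k-1)/2} / (q;q)_k`. -/
noncomputable def ex (N : ℕ) (v : R) : R := ∑ k ∈ range N, (-v) ^ k * qz (tri k) * iq k

theorem ex_step (N : ℕ) (v : R) (hv : v ^ N = 0) : ex N v = (1 - v) * ex N (v * qz 1) := by
  set c : ℕ → R := fun k => (-v) ^ k * qz (tri k) * iq k with hc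
  have h1 : ex N (v * qz 1) = ∑ k ∈ range N, c k * qz k := by
    refine sum_congr rfl fun k _ => ?_
    have : (-(v * qz 1)) ^ k = (-v) ^ k * qz k := by
      rw [← neg_mul, mul_pow, qz_pow, one_mul]
    rw [this, hc]
    ring
  have h2 : ∀ k, -v * (c k * qz k) = c (k + 1) - c (k + 1) * qz ((k + 1 : ℕ) : ℤ) := by
    intro k
    simp only [hc, tri_succ, qz_add, iq_eq_succ k]
    push_cast
    rw [qz_add]
    ring
  have hN : c N = 0 := by
    simp only [hc]
    rw [neg_pow, hv]; simp
  rw [h1, sub_mul, one_mul, sub_eq_add_neg, ← neg_mul, mul_sum]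
  simp only [h2, sum_sub_distrib]
  have e1 := sum_range_succ' c N
  have e2 := sum_range_succ' (fun k => c k * qz k) N
  rw [sum_range_succ, hN] at e1 e2
  simp only [Nat.cast_zero, qz_zero] at e2
  change ∑ k ∈ range N, c k = _
  linear_combination e1 - e2

theorem ex_eq_pc_mul (N : ℕ) (v : R) (hv : v ^ N = 0) (m : ℕ) :
    ex N v = pc v m * ex N (v * qz m) := by
  induction m with
  | zero => simp
  | succ m ih =>
    rw [ih, ex_step N (v * qz m) (by rw [mul_pow, hv, zero_mul]), pc_succ, Nat.cast_succ, qz_add]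
    ring_nf

theorem isUnit_ex (N : ℕ) (hN : 0 < N) (v : R) (hv : v ^ N = 0) : IsUnit (ex N v) := by
  obtain ⟨N, rfl⟩ := Nat.exists_eq_succ_of_ne_zero hN.ne'
  rw [ex, sum_range_succ']
  simp only [pow_zero, tri_zero, qz_zero, iq_zero, mul_one]
  refine IsNilpotent.isUnit_add_one ?_
  have : ∑ k ∈ range N, (-v) ^ (k + 1) * qz (tri (k + 1)) * iq (k + 1)
      = v * ∑ k ∈ range N, -((-v) ^ k * qz (tri (k + 1)) * iq (k + 1)) := by
    rw [mul_sum]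
    exact sum_congr rfl fun k _ => by ring
  rw [this]
  exact ⟨N + 1, by rw [mul_pow, hv, zero_mul]⟩

/-- Reindexing a double sum over a triangle. -/
theorem sum_triangle {A : Type*} [AddCommMonoid A] (n : ℕ) (h : ℕ → ℕ → A) :
    ∑ J ∈ range n, ∑ i ∈ range (J + 1), h i (J - i)
      = ∑ i ∈ range n, ∑ j ∈ range n, if i + j < n then h i j else 0 := by
  simp only [← sum_filter]
  rw [sum_sigma', sum_sigma']
  refine sum_nbij' (fun p => ⟨p.2, p.1 - p.2⟩) (fun p => ⟨p.1 + p.2, p.1⟩) ?_ ?_ ?_ ?_ ?_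
  · rintro ⟨a, b⟩ h; simp at h ⊢; omega
  · rintro ⟨a, b⟩ h; simp at h ⊢; omega
  · rintro ⟨a, b⟩ h; simp at h ⊢; omega
  · rintro ⟨a, b⟩ h; simp at h ⊢
  · rintro ⟨a, b⟩ h; rfl

/-- The polynomial `∑_j [M,j] (-X)^j q^{j(j-1)/2} (vW)_j (v q^j)_{M-j}`. -/
noncomputable def sp (M : ℕ) (X v W : R) : R :=
  ∑ j ∈ range (M + 1), gb M j * ((-X) ^ j * qz (tri j)) * pc (v * W) j * pc (v * qz j) (M - j)

theorem sp_eq_triple (M : ℕ) (X v W : R) :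
    sp M X v W = ∑ i ∈ range (M + 1), ∑ j ∈ range (M + 1), ∑ k ∈ range (M + 1),
      qf M * iq i * iq j * iq k * iz M (i + j + k) * (X * v * W) ^ i * (-X) ^ j * (-v) ^ k *
        qz (2 * tri i + tri j + tri k + i * j + i * k + j * k) := by
  obtain ⟨F, hF⟩ : ∃ F : ℕ → ℕ → R, ∀ i j, F i j = ∑ k ∈ range (M + 1),
      qf M * iq i * iq j * iq k * iz M (i + j + k) * (X * v * W) ^ i * (-X) ^ j * (-v) ^ k *
        qz (2 * tri i + tri j + tri k + i * j + i * k + j * k) := ⟨_, fun _ _ => rfl⟩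
  have key : ∀ J ∈ range (M + 1),
      gb M J * ((-X) ^ J * qz (tri J)) * pc (v * W) J * pc (v * qz J) (M - J)
      = ∑ i ∈ range (J + 1), F i (J - i) := by
    intro J hJ
    rw [mem_range] at hJ
    rw [← sum_gb (v * W) J (J + 1) (by omega), mul_sum, sum_mul]
    refine sum_congr rfl fun i hi => ?_
    rw [mem_range] at hi
    obtain ⟨j, rfl⟩ := Nat.exists_eq_add_of_le (show i ≤ J by omega)
    rw [← sum_gb (v * qz _) (M - (i + j)) (M + 1) (by omega), mul_sum, hF]
    refine sum_congr rfl fun k _ => ?_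
    have e0 : i + j - i = j := by omega
    have e1 : (gb M (i + j) * gb (i + j) i * gb (M - (i + j)) k : R)
        = qf M * iq i * iq j * iq k * iz M (i + j + k) := by
      simp only [gb, iz_add, iz_of_le (show i + j ≤ M by omega)]
      have e3 : (iz (M - (i + j)) k : R) = iz M (i + j + k) := by
        simp only [iz]
        congr 1
        · simp only [eq_iff_iff]; omega
        · congr 1; omega
      rw [e3]
      linear_combination (qf M * iq i * iq j * iq k * iz M (i + j + k)) *
        (qf (i + j) * iq (i + j) * qf_mul_iq (R := R) (M - (i + j)) + qf_mul_iq (R := R) (i + j))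
    have e2 : (qz (tri (i + j)) * qz (tri i) * (qz ((i + j : ℕ) : ℤ) ^ k * qz (tri k)) : R)
        = qz (2 * tri i + tri j + tri k + i * j + i * k + j * k) := by
      rw [qz_pow, ← qz_add, ← qz_add, ← qz_add]
      congr 1
      have h1 := two_mul_tri i
      have h2 := two_mul_tri j
      have h3 := two_mul_tri (i + j)
      push_cast at h3 ⊢
      linarith
    rw [e0, ← e1, ← e2, neg_pow (v * W), neg_pow (v * qz _), neg_pow X (i + j), neg_pow X j,
      neg_pow v]
    have e4 : ((-1 : R) ^ i) * (-1) ^ i = 1 := by rw [← mul_pow]; simp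
    simp only [mul_pow, pow_add]
    linear_combination (gb M (i + j) * gb (i + j) i * gb (M - (i + j)) k * (-1) ^ j * X ^ i * X ^ j *
      v ^ i * W ^ i * (-1) ^ k * v ^ k * qz (tri (i + j)) * qz (tri i) *
      (qz ((i + j : ℕ) : ℤ) ^ k * qz (tri k))) * e4
  simp only [← hF]
  rw [sp, sum_congr rfl key, sum_triangle]
  refine sum_congr rfl fun i _ => sum_congr rfl fun j _ => ?_
  split_ifs with h
  · rfl
  · rw [hF]
    symm
    refine sum_eq_zero fun k _ => ?_
    rw [iz_of_lt (show M < i + j + k by omega)]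
    ring

theorem sp_symm (M : ℕ) (X v W : R) : sp M X v W = sp M v X W := by
  rw [sp_eq_triple, sp_eq_triple]
  refine sum_congr rfl fun i _ => ?_
  rw [sum_comm]
  refine sum_congr rfl fun j _ => sum_congr rfl fun k _ => ?_
  rw [show i + k + j = i + j + k by omega,
    show 2 * tri i + tri k + tri j + (i : ℤ) * k + i * j + k * j
      = 2 * tri i + tri j + tri k + i * j + i * k + j * k by ring]
  ring

/-- The sum `∑_k [N,k] (-v)^k q^{k(k-1)/2} (X q^k)_M`. -/
noncomputable def sd (N M : ℕ) (v X : R) : R :=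
  ∑ k ∈ range (N + 1), gb N k * ((-v) ^ k * qz (tri k)) * pc (X * qz k) M

theorem sd_symm (N M : ℕ) (v X : R) : sd N M v X = sd M N X v := by
  simp only [sd]
  simp only [← sum_gb (_ * qz _) M (M + 1) (by omega), ← sum_gb (_ * qz _) N (N + 1) (by omega),
    mul_sum]
  rw [sum_comm]
  refine sum_congr rfl fun j _ => sum_congr rfl fun k _ => ?_
  rw [← neg_mul, ← neg_mul, mul_pow, mul_pow, qz_pow, qz_pow, mul_comm (k : ℤ)]
  ring

theorem pc_mul_sd (N M : ℕ) (v X : R) :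
    pc v M * sd N M v X = pc v N * sp M X v (qz N) := by
  rw [sd_symm, sd, sp, mul_sum, mul_sum]
  refine sum_congr rfl fun j hj => ?_
  rw [mem_range] at hj
  have h1 := pc_add v j (M - j)
  rw [Nat.add_sub_cancel' (by omega)] at h1
  have h2 := pc_add v j N
  rw [add_comm, pc_add] at h2
  rw [h1]
  linear_combination (-gb M j * ((-X) ^ j * qz (tri j)) * pc (v * qz j) (M - j)) * h2

/-- Euler's transformation of a terminating `₂φ₁`, in polynomial form. -/
theorem pc_mul_sd_symm (N M : ℕ) (v X : R) :
    pc v M * pc X N * sd N M v X = pc v N * pc X M * sd M N v X := by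
  have h1 := pc_mul_sd N M v X
  have h2 := pc_mul_sd N M X v
  rw [sd_symm N M X v, sp_symm] at h2
  linear_combination pc X N * h1 - pc v N * h2

/-- The limiting case of Euler's transformation with one unbounded side. -/
theorem sum_pc_eq_ex_mul_sp (N M : ℕ) (v X : R) (hv : v ^ N = 0) :
    ∑ k ∈ range N, (-v) ^ k * qz (tri k) * iq k * pc (X * qz k) M
      = ex N (v * qz M) * sp M v X 0 := by
  rw [sp_symm, sp, mul_sum]
  have h : ∀ j ∈ range (M + 1), ex N (v * qz M) * (gb M j * ((-X) ^ j * qz (tri j)) *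
      pc (v * 0) j * pc (v * qz j) (M - j)) = gb M j * ((-X) ^ j * qz (tri j)) * ex N (v * qz j) := by
    intro j hj
    rw [mem_range] at hj
    rw [ex_eq_pc_mul N (v * qz j) (by rw [mul_pow, hv, zero_mul]) (M - j), mul_assoc v, ← qz_add,
      Nat.cast_sub (by omega), add_sub_cancel]
    simp
    ring
  rw [sum_congr rfl h]
  simp only [← sum_gb (_ * qz _) M (M + 1) (by omega), ex, mul_sum]
  rw [sum_comm]
  refine sum_congr rfl fun j _ => sum_congr rfl fun k _ => ?_
  rw [← neg_mul, ← neg_mul, mul_pow, mul_pow, qz_pow, qz_pow, mul_comm (k : ℤ)]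
  ring

/-! ### Sums over descending sequences in a box -/

/-- Extension of a finite sequence by zero. -/
def extend (T : ℕ) (f : Fin T → ℕ) : ℕ → ℕ := fun t => if h : t < T then f ⟨t, h⟩ else 0

theorem extend_of_lt {T t : ℕ} (f : Fin T → ℕ) (h : t < T) : extend T f t = f ⟨t, h⟩ := dif_pos h

theorem extend_of_le {T t : ℕ} (f : Fin T → ℕ) (h : T ≤ t) : extend T f t = 0 :=
  dif_neg (by omega)

theorem extend_injective (T : ℕ) : Function.Injective (extend T) := by
  intro f g h
  funext i
  have := congrFun h i
  rwa [extend_of_lt f i.2, extend_of_lt g i.2] at this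

open Classical in
/-- The descending sequences of length and height at most `T`. -/
noncomputable def box (T : ℕ) : Finset (ℕ → ℕ) :=
  {r ∈ (Fintype.piFinset fun _ : Fin T => range (T + 1)).image (extend T) | Antitone r}

theorem mem_box {T : ℕ} {r : ℕ → ℕ} :
    r ∈ box T ↔ Antitone r ∧ r 0 ≤ T ∧ ∀ t, T ≤ t → r t = 0 := by
  classical
  rw [box, mem_filter, mem_image]
  constructor
  · rintro ⟨⟨f, hf, rfl⟩, h⟩
    refine ⟨h, ?_, fun t ht => extend_of_le f ht⟩
    rcases Nat.eq_zero_or_pos T with rfl | hT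
    · simp [extend]
    · rw [extend_of_lt f hT]
      have := Fintype.mem_piFinset.1 hf ⟨0, hT⟩
      rw [mem_range] at this
      omega
  · rintro ⟨h, h0, hT⟩
    refine ⟨⟨fun i => r i, ?_, ?_⟩, h⟩
    · rw [Fintype.mem_piFinset]
      intro i
      have := h (Nat.zero_le i)
      rw [mem_range]
      omega
    · funext t
      by_cases ht : t < T
      · rw [extend_of_lt _ ht]
      · rw [extend_of_le _ (by omega), hT t (by omega)]

theorem antitone_of_mem_box {T : ℕ} {r : ℕ → ℕ} (h : r ∈ box T) : Antitone r := (mem_box.1 h).1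

theorem succ_le_of_mem_box {T : ℕ} {r : ℕ → ℕ} (h : r ∈ box T) (t : ℕ) : r (t + 1) ≤ r t :=
  (mem_box.1 h).1 t.le_succ

theorem le_of_mem_box {T : ℕ} {r : ℕ → ℕ} (h : r ∈ box T) (t : ℕ) : r t ≤ T :=
  ((mem_box.1 h).1 (Nat.zero_le t)).trans (mem_box.1 h).2.1

theorem eq_zero_of_mem_box {T : ℕ} {r : ℕ → ℕ} (h : r ∈ box T) {t : ℕ} (ht : T ≤ t) : r t = 0 :=
  (mem_box.1 h).2.2 t ht

/-- A sum over descending sequences decouples when consecutive entries are separated by fixed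
thresholds. -/
theorem sum_box_prod {A : Type*} [CommRing A] (T : ℕ) (F : ℕ → ℕ → A) (lo : ℕ → ℕ)
    (h1 : ∀ t k, k < lo t → F t k = 0) (h2 : ∀ t k, lo t < k → F (t + 1) k = 0) :
    ∑ r ∈ box T, ∏ t ∈ range T, F t (r t) = ∏ t ∈ range T, ∑ k ∈ range (T + 1), F t k := by
  classical
  rw [← Fin.prod_univ_eq_prod_range (fun t => ∑ k ∈ range (T + 1), F t k) T, prod_univ_sum]
  have : ∑ f ∈ Fintype.piFinset fun _ : Fin T => range (T + 1), ∏ t : Fin T, F t (f t)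
      = ∑ r ∈ (Fintype.piFinset fun _ : Fin T => range (T + 1)).image (extend T),
          ∏ t ∈ range T, F t (r t) := by
    rw [sum_image fun a _ b _ h => extend_injective T h]
    refine sum_congr rfl fun f _ => ?_
    rw [← Fin.prod_univ_eq_prod_range (fun t => F t (extend T f t)) T]
    exact prod_congr rfl fun t _ => by rw [extend_of_lt f t.2]
  rw [this, box]
  refine sum_subset (filter_subset _ _) fun r hr hr' => ?_
  by_contra hne
  refine hr' (mem_filter.2 ⟨hr, antitone_nat_of_succ_le fun t => ?_⟩)
  obtain ⟨f, -, rfl⟩ := mem_image.1 hr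
  by_cases ht : t + 1 < T
  · by_contra hlt
    rcases lt_or_ge (extend T f t) (lo t) with h | h
    · exact hne (prod_eq_zero (mem_range.2 (show t < T by omega)) (h1 _ _ h))
    · exact hne (prod_eq_zero (mem_range.2 ht) (h2 _ _ (by omega)))
  · rw [extend_of_le f (by omega)]
    exact Nat.zero_le _

/-- Factors attached to the next entry, moved to that entry. -/
def lag {A : Type*} [One A] (G : ℕ → ℕ → A) : ℕ → ℕ → A
  | 0, _ => 1
  | t + 1, k => G t k

theorem lag_succ {A : Type*} [One A] (G : ℕ → ℕ → A) (t k : ℕ) : lag G (t + 1) k = G t k := rfl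

theorem prod_lag {A : Type*} [CommMonoid A] (G : ℕ → ℕ → A) (r : ℕ → ℕ) (T : ℕ) :
    (∏ t ∈ range T, lag G t (r t)) * lag G T (r T) = ∏ t ∈ range T, G t (r (t + 1)) := by
  rw [← prod_range_succ (fun t => lag G t (r t)), prod_range_succ']
  simp [lag]

theorem sum_box_prod_lag {A : Type*} [CommRing A] (T : ℕ) (f G : ℕ → ℕ → A) (lo : ℕ → ℕ)
    (h1 : ∀ t k, k < lo t → f t k = 0) (h2 : ∀ t k, lo t < k → f (t + 1) k * G t k = 0) :
    ∑ r ∈ box T, ∏ t ∈ range T, (f t (r t) * G t (r (t + 1)))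
      = (∏ t ∈ range T, ∑ k ∈ range (T + 1), f t k * lag G t k) * lag G T 0 := by
  rw [← sum_box_prod T (fun t k => f t k * lag G t k) lo (fun t k h => by rw [h1 t k h, zero_mul])
    (fun t k h => h2 t k h), sum_mul]
  refine sum_congr rfl fun r hr => ?_
  rw [prod_mul_distrib, ← prod_lag, eq_zero_of_mem_box hr le_rfl, ← mul_assoc, prod_mul_distrib]

theorem sum_range_shift {A : Type*} [AddCommMonoid A] (f : ℕ → A) (a n M : ℕ) (h : a + n ≤ M)
    (hlo : ∀ k, k < a → f k = 0) (hhi : ∀ k, a + n ≤ k → k < M → f k = 0) :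
    ∑ k ∈ range M, f k = ∑ j ∈ range n, f (a + j) := by
  have h1 : ∑ k ∈ range M, f k = ∑ k ∈ range (a + n), f k := by
    symm
    refine sum_subset (range_mono h) fun k hk hk' => ?_
    rw [mem_range] at hk hk'
    exact hhi k (by omega) hk
  rw [h1, sum_range_add, sum_eq_zero fun k hk => hlo k (mem_range.1 hk), zero_add]

/-! ### The kernels -/

/-- The kernel `D_z`. -/
noncomputable def dk (T : ℕ) (z : R) (μ ν : ℕ → ℕ) : R :=
  ∏ t ∈ range T, (z ^ (μ t - ν t) * qz ((ν t : ℤ) ^ 2 - ν t * μ t) * qf (μ t - ν (t + 1)) *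
    iz (ν t) (ν (t + 1)) * iz (μ t) (ν t))

/-- The kernel `E_z`, inverse to `D_z`. -/
noncomputable def ek (T : ℕ) (z : R) (μ ν : ℕ → ℕ) : R :=
  ∏ t ∈ range T, ((-z) ^ (μ t - ν t) * qz (tri (ν t) - tri (μ t)) * qf (μ t - μ (t + 1)) *
    iz (μ t) (ν t) * iz (ν t) (μ (t + 1)))

/-- The kernel `U_x`. -/
noncomputable def uk (T : ℕ) (x : R) (κ ν : ℕ → ℕ) : R :=
  ∏ t ∈ range T, (x ^ (ν t - κ t) * qz ((ν t : ℤ) ^ 2 - ν t * κ t) * qf (ν t - κ (t + 1)) *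
    iz (ν t) (ν (t + 1)) * iz (ν t) (κ t))

/-- The kernel `K_y`. -/
noncomputable def kk (T : ℕ) (y : R) (μ r : ℕ → ℕ) : R :=
  ∏ t ∈ range T, (y ^ r t * qz ((r t : ℤ) ^ 2 - r t * μ t) * iz (r t) (r (t + 1)))

theorem sum_alternating (n : ℕ) (hn : 0 < n) :
    ∑ j ∈ range (n + 1), (-1 : R) ^ j * qz (tri j + j - j * n) * iq j * iq (n - j) = 0 := by
  have h := sum_gb (qz (1 - n) : R) n (n + 1) (by omega)
  have h0 : pc (qz (1 - n) : R) n = 0 := by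
    obtain ⟨m, rfl⟩ := Nat.exists_eq_succ_of_ne_zero hn.ne'
    rw [Nat.succ_eq_add_one, pc_succ, ← qz_add]
    push_cast
    rw [show (1 : ℤ) - (m + 1) + m = 0 by ring]
    simp
  rw [h0] at h
  refine (isUnit_qf n).mul_right_eq_zero.1 ?_
  rw [← h, mul_sum]
  refine sum_congr rfl fun j hj => ?_
  rw [gb, iz_of_le (by rw [mem_range] at hj; omega), neg_pow (qz _), qz_pow,
    show tri j + j - j * (n : ℤ) = (1 - n) * j + tri j by ring, qz_add]
  ring

open Classical in
theorem sum_dk_mul_ek (T : ℕ) (z : R) {μ κ : ℕ → ℕ} (hμ : μ ∈ box T) (hκ : κ ∈ box T) :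
    ∑ r ∈ box T, dk T z μ r * ek T z r κ = if μ = κ then 1 else 0 := by
  set f : ℕ → ℕ → R := fun t k => z ^ (μ t - k) * (-z) ^ (k - κ t) *
    qz ((k : ℤ) ^ 2 - k * μ t + tri (κ t) - tri k) * iz (μ t) k * iz k (κ t) with hf
  set G : ℕ → ℕ → R := fun t k => qf (μ t - k) * iz (κ t) k with hG
  have h1 : ∀ r ∈ box T, dk T z μ r * ek T z r κ
      = ∏ t ∈ range T, (f t (r t) * G t (r (t + 1))) := by
    intro r hr
    rw [dk, ek, ← prod_mul_distrib]
    refine prod_congr rfl fun t _ => ?_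
    simp only [hf, hG]
    rw [add_sub_assoc, qz_add]
    linear_combination (z ^ (μ t - r t) * qz ((r t : ℤ) ^ 2 - r t * μ t) * qf (μ t - r (t + 1)) *
      iz (μ t) (r t) * ((-z) ^ (r t - κ t) * qz (tri (κ t) - tri (r t)) *
    iz (r t) (κ t) * iz (κ t) (r (t + 1)))) * qf_mul_iz (R := R) (succ_le_of_mem_box hr t)
  rw [sum_congr rfl h1, sum_box_prod_lag T f G κ
    (fun t k h => by simp only [hf]; rw [iz_of_lt h, mul_zero])
    (fun t k h => by simp only [hG]; rw [iz_of_lt h, mul_zero, mul_zero])]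
  split_ifs with h
  · subst h
    have h2 : ∀ t ∈ range T, ∑ k ∈ range (T + 1), f t k * lag G t k = 1 := by
      intro t _
      rw [sum_eq_single (μ t)]
      · have : lag G t (μ t) = 1 := by
          cases t with
          | zero => rfl
          | succ t => exact qf_mul_iz (succ_le_of_mem_box hμ t)
        rw [this]
        simp only [hf]
        rw [show (μ t : ℤ) ^ 2 - μ t * μ t + tri (μ t) - tri (μ t) = 0 by ring]
        simp
      · intro k _ hk
        simp only [hf]
        rcases lt_or_gt_of_ne hk with h | h <;> simp [iz_of_lt h]
      · intro h
        have := le_of_mem_box hμ t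
        rw [mem_range] at h
        omega
    rw [prod_congr rfl h2, prod_const_one, one_mul]
    cases T with
    | zero => rfl
    | succ T => exact qf_mul_iz (Nat.zero_le _)
  · have hex : ∃ t, μ t ≠ κ t := by
      by_contra h'
      push Not at h'
      exact h (funext h')
    obtain ⟨t, ht, hmin⟩ : ∃ t, μ t ≠ κ t ∧ ∀ s < t, μ s = κ s :=
      ⟨Nat.find hex, Nat.find_spec hex, fun s hs => not_not.1 (Nat.find_min hex hs)⟩
    have htT : t < T := by
      by_contra hT
      exact ht (by rw [eq_zero_of_mem_box hμ (by omega), eq_zero_of_mem_box hκ (by omega)])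
    rw [prod_eq_zero (mem_range.2 htT), zero_mul]
    rcases lt_or_gt_of_ne ht with hlt | hgt
    · refine sum_eq_zero fun k _ => ?_
      simp only [hf]
      rcases lt_or_ge k (κ t) with h | h
      · simp [iz_of_lt h]
      · simp [iz_of_lt (show μ t < k by omega)]
    · obtain ⟨n, hn⟩ := Nat.exists_eq_add_of_lt hgt
      have hle := le_of_mem_box hμ t
      rw [sum_range_shift _ (κ t) (n + 1 + 1) (T + 1) (by omega)
        (fun k h => by simp only [hf]; rw [iz_of_lt h]; simp)
        (fun k h _ => by simp only [hf]; rw [iz_of_lt (show μ t < k by omega)]; simp)]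
      have key := sum_alternating (R := R) (n + 1) (by omega)
      have : (z ^ (n + 1) * qz (-(κ t * (n + 1) : ℤ)) : R) *
          ∑ j ∈ range (n + 1 + 1), (-1 : R) ^ j * qz (tri j + j - j * (n + 1 : ℕ)) * iq j *
            iq (n + 1 - j) = 0 := by
        rw [key, mul_zero]
      rw [← this, mul_sum]
      refine sum_congr rfl fun j hj => ?_
      rw [mem_range] at hj
      have hlag : lag G t (κ t + j) = 1 := by
        cases t with
        | zero => rfl
        | succ t =>
          have := succ_le_of_mem_box hμ t
          have e := hmin t (by omega)
          simp only [lag, hG]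
          rw [e]
          exact qf_mul_iz (by omega)
      rw [hlag]
      simp only [hf]
      rw [iz_add, iz_of_le (by omega), show μ t - (κ t + j) = n + 1 - j by omega,
        show κ t + j - κ t = j by omega, neg_pow z j,
        show ((κ t + j : ℕ) : ℤ) ^ 2 - (κ t + j : ℕ) * μ t + tri (κ t) - tri (κ t + j)
          = -(κ t * (n + 1) : ℤ) + (tri j + j - j * (n + 1 : ℕ)) by
          have a1 := two_mul_tri (κ t + j)
          have a2 := two_mul_tri (κ t)
          have a3 := two_mul_tri j
          rw [hn]
          push_cast at a1 ⊢
          linarith, qz_add, ← pow_sub_mul_pow z (show j ≤ n + 1 by omega)]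
      ring

/-- The kernel `k` as a matrix indexed by the box. -/
def mat {A : Type*} (T : ℕ) (k : (ℕ → ℕ) → (ℕ → ℕ) → A) : Matrix (box T) (box T) A :=
  Matrix.of fun μ ν => k μ ν

theorem mat_mul_apply {A : Type*} [CommRing A] (T : ℕ) (k k' : (ℕ → ℕ) → (ℕ → ℕ) → A)
    (μ ν : box T) :
    (mat T k * mat T k') μ ν = ∑ r ∈ box T, k μ r * k' r ν := by
  rw [Matrix.mul_apply, ← sum_coe_sort (box T) fun r => k μ r * k' r ν]
  rfl

open Classical in
theorem mat_dk_mul_ek (T : ℕ) (z : R) : mat T (dk T z) * mat T (ek T z) = 1 := by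
  ext μ ν
  rw [mat_mul_apply, sum_dk_mul_ek T z μ.2 ν.2, Matrix.one_apply]
  simp only [Subtype.ext_iff]

open Classical in
theorem mat_ek_mul_dk (T : ℕ) (z : R) : mat T (ek T z) * mat T (dk T z) = 1 :=
  mul_eq_one_comm.1 (mat_dk_mul_ek T z)

theorem ex_qz_eq_pc_mul {N : ℕ} {u : R} (hu : u ^ N = 0) (a b : ℤ) (n : ℕ) (h : b = a + n) :
    ex N (u * qz a) = pc (u * qz a) n * ex N (u * qz b) := by
  rw [ex_eq_pc_mul N (u * qz a) (by rw [mul_pow, hu, zero_mul]) n, mul_assoc, ← qz_add, h]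

/-- The inverse of the generating function `∏ (1 - u q^n)⁻¹`, for nilpotent `u`. -/
noncomputable def gi (N : ℕ) (u : R) : R := ex N (u * qz 1)

theorem prod_pow_eq_zero {A : Type*} [CommRing A] {N T : ℕ} {y : A} (hy : y ^ N = 0) {ν : ℕ → ℕ}
    (h : N ≤ ∑ t ∈ range T, ν t) : ∏ t ∈ range T, y ^ ν t = 0 := by
  rw [prod_pow_eq_pow_sum]
  exact pow_eq_zero_of_le h hy

theorem le_sum_of_mem_box {T : ℕ} {ν : ℕ → ℕ} (hν : ν ∈ box (T + 1)) (h : ν T ≠ 0) :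
    T + 1 ≤ ∑ t ∈ range (T + 1), ν t := by
  have : ∀ t ∈ range (T + 1), 1 ≤ ν t := by
    intro t ht
    have := antitone_of_mem_box hν (show t ≤ T by rw [mem_range] at ht; omega)
    omega
  simpa using sum_le_sum this

section KE

variable {T N : ℕ} {y z : R} {μ ν : ℕ → ℕ}

theorem sum_kk_mul_ek (hy : y ^ N = 0) (hT : 2 * N ≤ T) (hν : ν ∈ box T) :
    ∑ r ∈ box T, kk T y μ r * ek T z r ν
      = (∏ t ∈ range T, (y ^ ν t * qz ((ν t : ℤ) ^ 2 - ν t * μ t) * iz (ν t) (ν (t + 1)))) *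
        (ex N (y * z * qz (ν 0 - μ 0 + 1)) *
        ∏ t ∈ range T, pc (y * z * qz (ν (t + 1) - μ (t + 1) + 1)) (ν t - ν (t + 1))) := by
  set f : ℕ → ℕ → R := fun t k => y ^ k * qz ((k : ℤ) ^ 2 - k * μ t + (tri (ν t) - tri k)) *
    (-z) ^ (k - ν t) * iz k (ν t) with hf
  set G : ℕ → ℕ → R := fun t k => iz (ν t) k with hG
  have h1 : ∀ r ∈ box T, kk T y μ r * ek T z r ν
      = ∏ t ∈ range T, (f t (r t) * G t (r (t + 1))) := by
    intro r hr
    rw [kk, ek, ← prod_mul_distrib]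
    refine prod_congr rfl fun t _ => ?_
    simp only [hf, hG]
    rw [qz_add]
    linear_combination (y ^ r t * qz ((r t : ℤ) ^ 2 - r t * μ t) *
      ((-z) ^ (r t - ν t) * qz (tri (ν t) - tri (r t)) *
    iz (r t) (ν t) * iz (ν t) (r (t + 1)))) * qf_mul_iz (R := R) (succ_le_of_mem_box hr t)
  rw [sum_congr rfl h1, sum_box_prod_lag T f G ν
    (fun t k h => by simp only [hf]; rw [iz_of_lt h, mul_zero])
    (fun t k h => by simp only [hG]; rw [iz_of_lt h, mul_zero])]
  set g : ℕ → R := fun t => y ^ ν t * qz ((ν t : ℤ) ^ 2 - ν t * μ t) with hg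
  set H : ℕ → ℕ → R := fun t k =>
    pc (y * z * qz (ν (t + 1) - μ (t + 1) + 1)) (ν t - ν (t + 1)) * iz (ν t) k with hH
  have hexp : ∀ t j : ℕ, ((ν t + j : ℕ) : ℤ) ^ 2 - (ν t + j : ℕ) * μ t + (tri (ν t) - tri (ν t + j))
      = ((ν t : ℤ) ^ 2 - ν t * μ t) + ((ν t - μ t + 1) * j + tri j) := by
    intro t j
    have a1 := two_mul_tri (ν t + j)
    have a2 := two_mul_tri (ν t)
    have a3 := two_mul_tri j
    push_cast at a1 ⊢
    linarith
  have hterm : ∀ t j : ℕ, f t (ν t + j)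
      = g t * ((-(y * z * qz (ν t - μ t + 1))) ^ j * qz (tri j) * iq j) := by
    intro t j
    simp only [hf, hg]
    rw [hexp, qz_add, qz_add, iz_add, show ν t + j - ν t = j by omega, ← qz_pow, ← neg_mul,
      mul_pow, neg_pow (y * z), mul_pow, neg_pow z, pow_add]
    ring
  have hlevel0 : ∑ k ∈ range (T + 1), f 0 k * lag G 0 k
      = g 0 * ex N (y * z * qz (ν 0 - μ 0 + 1)) := by
    rcases le_or_gt N (ν 0) with hN | hN
    · have : y ^ ν 0 = 0 := pow_eq_zero_of_le hN hy
      simp only [hg]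
      rw [this, zero_mul, zero_mul]
      refine sum_eq_zero fun k _ => ?_
      simp only [hf]
      rcases lt_or_ge k (ν 0) with h | h
      · simp [iz_of_lt h]
      · rw [pow_eq_zero_of_le (hN.trans h) hy]
        simp
    · rw [sum_range_shift _ (ν 0) N (T + 1) (by omega)
        (fun k h => by simp only [hf]; rw [iz_of_lt h]; simp)
        (fun k h _ => by
          simp only [hf]; rw [pow_eq_zero_of_le (show N ≤ k by omega) hy]; simp), ex, mul_sum]
      refine sum_congr rfl fun j _ => ?_
      rw [hterm]
      simp [lag]
  have hlevel : ∀ t, ∑ k ∈ range (T + 1), f (t + 1) k * lag G (t + 1) k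
      = g (t + 1) * H t (ν (t + 1)) := by
    intro t
    have hle := succ_le_of_mem_box hν t
    have hle' := le_of_mem_box hν t
    rw [sum_range_shift _ (ν (t + 1)) (ν t - ν (t + 1) + 1) (T + 1) (by omega)
        (fun k h => by simp only [hf]; rw [iz_of_lt h]; simp)
        (fun k h _ => by simp only [lag, hG]; rw [iz_of_lt (by omega)]; simp)]
    simp only [hH]
    rw [← sum_gb _ (ν t - ν (t + 1)) (ν t - ν (t + 1) + 1) (by omega), sum_mul, mul_sum]
    refine sum_congr rfl fun j hj => ?_
    rw [mem_range] at hj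
    rw [hterm]
    simp only [lag, hG]
    rw [gb, iz_of_le (show ν (t + 1) + j ≤ ν t by omega), iz_of_le (show j ≤ _ by omega),
      show ν t - (ν (t + 1) + j) = ν t - ν (t + 1) - j by omega]
    linear_combination (- g (t + 1) * ((-(y * z * qz (ν (t + 1 ) - μ (t + 1) + 1))) ^ j *
      qz (tri j) * iq j) * iq (ν t - ν (t + 1) - j)) * qf_mul_iz (R := R) hle
  have hprod : ∀ n, n ≤ T → ∏ t ∈ range n, ∑ k ∈ range (T + 1), f t k * lag G t k
      = ∏ t ∈ range n, (g t * (if t = 0 then ex N (y * z * qz (ν 0 - μ 0 + 1)) else 1) *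
        lag H t (ν t)) := by
    intro n _
    refine prod_congr rfl fun t _ => ?_
    cases t with
    | zero => rw [hlevel0]; simp [lag]
    | succ t => rw [hlevel]; simp [lag]
  rcases Nat.eq_zero_or_pos T with rfl | hTpos
  · obtain rfl : N = 0 := by omega
    have : (1 : R) = 0 := by simpa using hy
    exact (subsingleton_of_zero_eq_one this.symm).elim _ _
  rw [hprod T le_rfl, prod_mul_distrib, prod_mul_distrib, prod_ite_eq_of_mem' _ _ _ (by simpa)]
  obtain ⟨S, rfl⟩ := Nat.exists_eq_succ_of_ne_zero hTpos.ne'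
  have hT0 : ν (S + 1) = 0 := eq_zero_of_mem_box hν le_rfl
  by_cases hS : ν S = 0
  · have e := prod_lag H ν (S + 1)
    have e' : lag H (S + 1) (ν (S + 1)) = lag G (S + 1) 0 := by
      simp [lag, hH, hG, hS, hT0]
    rw [e'] at e
    rw [mul_assoc, e]
    simp only [hH, hg, prod_mul_distrib]
    ring
  · have : ∏ t ∈ range (S + 1), y ^ ν t = 0 :=
      prod_pow_eq_zero hy ((show N ≤ S + 1 by omega).trans (le_sum_of_mem_box hν hS))
    simp only [hg, prod_mul_distrib, this, zero_mul]

theorem sum_ek_mul_kk (u : R) (hμ : μ ∈ box T) :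
    ∑ r ∈ box T, ek T u μ r * kk T y r ν
      = (∏ t ∈ range T, (y ^ ν t * qz ((ν t : ℤ) ^ 2 - ν t * μ t) * iz (ν t) (ν (t + 1)))) *
        ∏ t ∈ range T, pc (u * qz (ν t - μ t + 1)) (μ t - μ (t + 1)) := by
  set F : ℕ → ℕ → R := fun t k => (-u) ^ (μ t - k) * qz (tri k - tri (μ t)) *
    qf (μ t - μ (t + 1)) * iz (μ t) k * iz k (μ (t + 1)) *
    (y ^ ν t * qz ((ν t : ℤ) ^ 2 - ν t * k) * iz (ν t) (ν (t + 1))) with hF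
  have h1 : ∀ r ∈ box T, ek T u μ r * kk T y r ν = ∏ t ∈ range T, F t (r t) := by
    intro r _
    rw [kk, ek, ← prod_mul_distrib]
  rw [sum_congr rfl h1, sum_box_prod T F (fun t => μ (t + 1))
    (fun t k h => by simp only [hF]; rw [iz_of_lt h]; simp)
    (fun t k h => by simp only [hF]; rw [iz_of_lt h]; simp), ← prod_mul_distrib]
  refine prod_congr rfl fun t _ => ?_
  have hle := succ_le_of_mem_box hμ t
  have hle' := le_of_mem_box hμ t
  rw [sum_range_shift _ (μ (t + 1)) (μ t - μ (t + 1) + 1) (T + 1) (by omega)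
    (fun k h => by simp only [hF]; rw [iz_of_lt h]; simp)
    (fun k h _ => by simp only [hF]; rw [iz_of_lt (show μ t < k by omega)]; simp),
    ← sum_gb _ (μ t - μ (t + 1)) (μ t - μ (t + 1) + 1) (by omega), mul_sum, ← sum_range_reflect]
  refine sum_congr rfl fun j hj => ?_
  rw [mem_range] at hj
  obtain ⟨m, hm⟩ := Nat.exists_eq_add_of_le (show μ (t + 1) + j ≤ μ t by omega)
  simp only [hF]
  rw [show μ (t + 1) + (μ t - μ (t + 1) + 1 - 1 - j) = μ (t + 1) + m by omega, iz_add, gb,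
    iz_of_le (show μ (t + 1) + m ≤ μ t by omega), iz_of_le (show j ≤ _ by omega),
    show μ t - (μ (t + 1) + m) = j by omega, show μ t - μ (t + 1) - j = m by omega,
    ← neg_mul, mul_pow, qz_pow]
  have hexp : (qz (tri (μ (t + 1) + m) - tri (μ t)) *
      qz ((ν t : ℤ) ^ 2 - ν t * (μ (t + 1) + m : ℕ)) : R)
      = qz ((ν t : ℤ) ^ 2 - ν t * μ t) * (qz ((ν t - μ t + 1) * j) * qz (tri j)) := by
    rw [← qz_add, ← qz_add, ← qz_add]
    congr 1
    have e : (μ t : ℤ) = ((μ (t + 1) + m : ℕ) : ℤ) + j := by rw [hm]; push_cast; ring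
    have a1 := two_mul_tri (μ (t + 1) + m)
    have a2 := two_mul_tri (μ t)
    have a3 := two_mul_tri j
    generalize ((μ (t + 1) + m : ℕ) : ℤ) = x at *
    rw [e] at a2 ⊢
    linarith
  linear_combination ((-u) ^ j * qf (μ t - μ (t + 1)) * iq j * iq m * y ^ ν t *
    iz (ν t) (ν (t + 1))) * hexp

theorem ex_mul_prod_pc {u : R} (hu : u ^ N = 0) (hμ : Antitone μ) (hν : Antitone ν) (m : ℕ) :
    ex N (u * qz (ν 0 - μ 0 + 1)) *
        ∏ t ∈ range m, pc (u * qz (ν (t + 1) - μ (t + 1) + 1)) (ν t - ν (t + 1))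
      = ex N (u * qz (ν m - μ m + 1)) *
        ∏ t ∈ range m, pc (u * qz (ν t - μ t + 1)) (μ t - μ (t + 1)) := by
  induction m with
  | zero => simp
  | succ m ih =>
    have h1 : μ (m + 1) ≤ μ m := hμ m.le_succ
    have h2 : ν (m + 1) ≤ ν m := hν m.le_succ
    rw [prod_range_succ, prod_range_succ, ← mul_assoc, ih]
    have e1 := ex_qz_eq_pc_mul hu (ν m - μ m + 1) (ν m - μ (m + 1) + 1) (μ m - μ (m + 1))
      (by push_cast [h1]; ring)
    have e2 := ex_qz_eq_pc_mul hu (ν (m + 1) - μ (m + 1) + 1) (ν m - μ (m + 1) + 1)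
      (ν m - ν (m + 1)) (by push_cast [h2]; ring)
    rw [e1, e2]
    ring

theorem mat_kk_mul_ek (hy : y ^ N = 0) (hT : 2 * N ≤ T) :
    mat T (kk T y) * mat T (ek T z) = gi N (y * z) • (mat T (ek T (y * z)) * mat T (kk T y)) := by
  ext μ ν
  rw [Matrix.smul_apply, mat_mul_apply, mat_mul_apply, sum_kk_mul_ek hy hT ν.2,
    sum_ek_mul_kk _ μ.2, ex_mul_prod_pc (by rw [mul_pow, hy, zero_mul])
    (antitone_of_mem_box μ.2) (antitone_of_mem_box ν.2), eq_zero_of_mem_box μ.2 le_rfl,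
    eq_zero_of_mem_box ν.2 le_rfl, smul_eq_mul, gi]
  simp only [Nat.cast_zero, sub_zero, zero_add]
  ring

theorem mat_dk_mul_kk (hy : y ^ N = 0) (hT : 2 * N ≤ T) :
    mat T (dk T (y * z)) * mat T (kk T y) = gi N (y * z) • (mat T (kk T y) * mat T (dk T z)) := by
  classical
  calc mat T (dk T (y * z)) * mat T (kk T y)
      = mat T (dk T (y * z)) * (mat T (kk T y) * mat T (ek T z)) * mat T (dk T z) := by
        rw [mul_assoc, mul_assoc, mat_ek_mul_dk, mul_one]
    _ = gi N (y * z) • ((mat T (dk T (y * z)) * mat T (ek T (y * z))) * mat T (kk T y) *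
          mat T (dk T z)) := by
        rw [mat_kk_mul_ek hy hT, mul_smul_comm, smul_mul_assoc]
        simp only [mul_assoc]
    _ = _ := by rw [mat_dk_mul_ek, one_mul]

end KE

theorem ex_mul_sd {N : ℕ} (hN : 0 < N) {v : R} (hv : v ^ N = 0) (d n m : ℕ) :
    ex N (v * qz n) * qf (d + n) * sd n m v (qz (d + 1))
      = ex N (v * qz m) * qf (d + m) * sd m n v (qz (d + 1)) := by
  have hu : IsUnit (pc v m) := by
    have := isUnit_ex N hN v hv
    rw [ex_eq_pc_mul N v hv m] at this
    exact isUnit_of_mul_isUnit_left this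
  refine hu.mul_left_cancel ?_
  have h1 := ex_eq_pc_mul N v hv m
  have h2 := ex_eq_pc_mul N v hv n
  have h3 := pc_mul_sd_symm n m v (qz (d + 1))
  rw [qf_add, qf_add]
  linear_combination ex N (v * qz n) * qf d * h3 +
    qf d * pc (qz (d + 1)) m * sd m n v (qz (d + 1)) * (h1 - h2)

theorem qf_mul_sum_eq_sp (d m : ℕ) (v : R) :
    qf (d + m) * ∑ j ∈ range (m + 1), gb m j * ((-v) ^ j * qz (tri j)) * iq (d + j)
      = sp m v (qz (d + 1)) 0 := by
  rw [sp, mul_sum]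
  refine sum_congr rfl fun j hj => ?_
  obtain ⟨i, rfl⟩ := Nat.exists_eq_add_of_le (show j ≤ m by rw [mem_range] at hj; omega)
  have := qf_add_mul_iq (R := R) (d + j) i
  rw [mul_zero, zero_pc, ← qz_add, show j + i - j = i by omega,
    show (d : ℤ) + 1 + j = (d + j : ℕ) + 1 by push_cast; ring, ← this, ← add_assoc]
  ring

section Level

variable {f f' : ℕ → R} {C W v : R} {c m d : ℕ}

theorem sum_upper_mul_iz {n M : ℕ} (hM : c + m + d + n < M) (hlo : ∀ k, k < c + m + d → f k = 0)
    (hf : ∀ j, f (c + m + d + j)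
      = C * ((-v) ^ j * qz (tri j) * iq j * pc (qz (d + 1) * qz j) m)) :
    ∑ k ∈ range M, f k * iz (c + m + d + n) k = C * iq n * sd n m v (qz (d + 1)) := by
  rw [sum_range_shift _ (c + m + d) (n + 1) M (by omega) (fun k h => by rw [hlo k h, zero_mul])
    (fun k h _ => by rw [iz_of_lt (by omega), mul_zero]), sd, mul_sum]
  refine sum_congr rfl fun j hj => ?_
  rw [mem_range] at hj
  rw [hf, gb, iz_of_le (show c + m + d + j ≤ c + m + d + n by omega), iz_of_le (by omega),
    show c + m + d + n - (c + m + d + j) = n - j by omega]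
  linear_combination (-C * ((-v) ^ j * qz (tri j) * iq j * pc (qz (d + 1) * qz j) m) *
    iq (n - j)) * qf_mul_iq (R := R) n

theorem sum_upper {N M : ℕ} (hv : v ^ N = 0) (hM : c + m + d + N ≤ M)
    (hlo : ∀ k, k < c + m + d → f k = 0)
    (hf : ∀ j, f (c + m + d + j)
      = C * ((-v) ^ j * qz (tri j) * iq j * pc (qz (d + 1) * qz j) m)) :
    ∑ k ∈ range M, f k = C * (ex N (v * qz m) * sp m v (qz (d + 1)) 0) := by
  rw [sum_range_shift _ (c + m + d) N M hM hlo, ← sum_pc_eq_ex_mul_sp N m v _ hv, mul_sum]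
  · exact sum_congr rfl fun j _ => hf j
  · intro k hk _
    obtain ⟨j, rfl⟩ := Nat.exists_eq_add_of_le (show c + m + d ≤ k by omega)
    have : (-v) ^ j = 0 := by
      rw [neg_pow, pow_eq_zero_of_le (show N ≤ j by omega) hv, mul_zero]
    rw [hf, this]
    simp

theorem sum_lower_mul (g : ℕ → R) {M : ℕ} (hM : c + m < M) (hlo : ∀ k, k < c → f' k = 0)
    (hhi : ∀ k, c + m < k → f' k = 0)
    (hf : ∀ i j, i + j = m → f' (c + i)
      = C * W * ((-v) ^ j * qz (tri j) * iq j * iq i * iq (d + j))) :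
    ∑ k ∈ range M, f' k * g k
      = C * W * iq m * ∑ j ∈ range (m + 1), gb m j * ((-v) ^ j * qz (tri j)) *
          (g (c + m - j) * iq (d + j)) := by
  rw [sum_range_shift _ c (m + 1) M (by omega) (fun k h => by rw [hlo k h, zero_mul])
    (fun k h _ => by rw [hhi k (by omega), zero_mul]), ← sum_range_reflect, mul_sum]
  refine sum_congr rfl fun j hj => ?_
  obtain ⟨i, rfl⟩ := Nat.exists_eq_add_of_le (show j ≤ m by rw [mem_range] at hj; omega)
  rw [show j + i + 1 - 1 - j = i by omega, hf i j (by omega), gb, iz_add,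
    show c + (j + i) - j = c + i by omega]
  linear_combination (-C * W * ((-v) ^ j * qz (tri j) * iq j * iq i * iq (d + j)) * g (c + i)) *
    qf_mul_iq (R := R) (j + i)

theorem sum_lower_mul_qf (n : ℕ) {M : ℕ} (hM : c + m < M) (hlo : ∀ k, k < c → f' k = 0)
    (hhi : ∀ k, c + m < k → f' k = 0)
    (hf : ∀ i j, i + j = m → f' (c + i)
      = C * W * ((-v) ^ j * qz (tri j) * iq j * iq i * iq (d + j))) :
    ∑ k ∈ range M, f' k * qf (c + m + d + n - k) = C * W * iq m * sd m n v (qz (d + 1)) := by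
  rw [sum_lower_mul _ hM hlo hhi hf, sd]
  congr 1
  refine sum_congr rfl fun j hj => ?_
  rw [mem_range] at hj
  rw [show c + m + d + n - (c + m - j) = d + j + n by omega, qf_add_mul_iq, ← qz_add]
  push_cast
  ring_nf

theorem sum_lower {M : ℕ} (hM : c + m < M) (hlo : ∀ k, k < c → f' k = 0)
    (hhi : ∀ k, c + m < k → f' k = 0)
    (hf : ∀ i j, i + j = m → f' (c + i)
      = C * W * ((-v) ^ j * qz (tri j) * iq j * iq i * iq (d + j))) :
    qf (d + m) * ∑ k ∈ range M, f' k = C * W * iq m * sp m v (qz (d + 1)) 0 := by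
  have := sum_lower_mul (fun _ => 1) hM hlo hhi hf
  simp only [mul_one, one_mul] at this
  rw [this, ← qf_mul_sum_eq_sp]
  ring

end Level

section UE

/-- The level factor of `U_x E_z`. -/
noncomputable def fa (x z : R) (κ κ' lam k : ℕ) : R :=
  x ^ (k - κ) * (-z) ^ (k - lam) * qz ((k : ℤ) ^ 2 - k * κ + (tri lam - tri k)) * qf (k - κ') *
    iz k κ * iz k lam

/-- The level factor of `E_z U_x`. -/
noncomputable def fb (x z : R) (κ κ' lam k : ℕ) : R :=
  (-z) ^ (κ - k) * x ^ (lam - k) * qz (tri k - tri κ + ((lam : ℤ) ^ 2 - lam * k)) * qf (κ - κ') *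
    iz κ k * iz k κ' * iz lam k

theorem fa_eq_zero_of_lt_left (x z : R) {κ κ' lam k : ℕ} (h : k < κ) : fa x z κ κ' lam k = 0 := by
  simp [fa, iz_of_lt h]

theorem fa_eq_zero_of_lt_right (x z : R) {κ κ' lam k : ℕ} (h : k < lam) :
    fa x z κ κ' lam k = 0 := by
  simp [fa, iz_of_lt h]

theorem fb_eq_zero_of_lt (x z : R) {κ κ' lam k : ℕ} (h : k < κ') : fb x z κ κ' lam k = 0 := by
  simp [fb, iz_of_lt h]

theorem fb_eq_zero_of_lt_left (x z : R) {κ κ' lam k : ℕ} (h : κ < k) : fb x z κ κ' lam k = 0 := by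
  simp [fb, iz_of_lt h]

theorem fb_eq_zero_of_lt_right (x z : R) {κ κ' lam k : ℕ} (h : lam < k) :
    fb x z κ κ' lam k = 0 := by
  simp [fb, iz_of_lt h]

theorem fa_of_le (x z : R) (c m d j : ℕ) :
    fa x z (c + m + d) c (c + m) (c + m + d + j)
      = (-z) ^ d * qz (tri (c + m) - tri (c + m + d)) *
        ((-(x * z * qz 1)) ^ j * qz (tri j) * iq j * pc (qz (d + 1) * qz j) m) := by
  have h := qf_add_mul_iq (R := R) (d + j) m
  rw [fa, iz_add, show c + m + d + j = c + m + (d + j) by omega, iz_add,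
    show c + m + (d + j) - (c + m + d) = j by omega,
    show c + m + (d + j) - (c + m) = d + j by omega, show c + m + (d + j) - c = d + j + m by omega,
    ← qz_add, show (d : ℤ) + 1 + j = (d + j : ℕ) + 1 by push_cast; ring, ← h, ← neg_mul, mul_pow,
    qz_pow]
  have e : (qz (((c + m + (d + j) : ℕ) : ℤ) ^ 2 - (c + m + (d + j) : ℕ) * (c + m + d : ℕ) +
      (tri (c + m) - tri (c + m + (d + j)))) : R)
      = qz (tri (c + m) - tri (c + m + d)) * (qz (1 * j) * qz (tri j)) := by
    rw [← qz_add, ← qz_add]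
    congr 1
    have a1 := two_mul_tri (c + m + (d + j))
    have a2 := two_mul_tri (c + m + d)
    have a3 := two_mul_tri j
    push_cast at a1 a2 ⊢
    linarith
  rw [e, pow_add, neg_pow (x * z), mul_pow, neg_pow z j]
  ring

theorem fa_of_ge (x z : R) (c m d j : ℕ) :
    fa x z (c + m) c (c + m + d) (c + m + d + j)
      = x ^ d * qz (((c + m + d : ℕ) : ℤ) ^ 2 - (c + m + d : ℕ) * (c + m : ℕ)) *
        ((-(x * z * qz (d + 1))) ^ j * qz (tri j) * iq j * pc (qz (d + 1) * qz j) m) := by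
  have h := qf_add_mul_iq (R := R) (d + j) m
  rw [fa, iz_add, show c + m + d + j = c + m + (d + j) by omega, iz_add,
    show c + m + (d + j) - (c + m + d) = j by omega,
    show c + m + (d + j) - (c + m) = d + j by omega, show c + m + (d + j) - c = d + j + m by omega,
    ← qz_add, show (d : ℤ) + 1 + j = (d + j : ℕ) + 1 by push_cast; ring, ← h, ← neg_mul, mul_pow,
    qz_pow]
  have e : (qz (((c + m + (d + j) : ℕ) : ℤ) ^ 2 - (c + m + (d + j) : ℕ) * (c + m : ℕ) +
      (tri (c + m + d) - tri (c + m + (d + j)))) : R)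
      = qz (((c + m + d : ℕ) : ℤ) ^ 2 - (c + m + d : ℕ) * (c + m : ℕ)) *
        (qz ((d + 1) * j) * qz (tri j)) := by
    rw [← qz_add, ← qz_add]
    congr 1
    have a1 := two_mul_tri (c + m + (d + j))
    have a2 := two_mul_tri (c + m + d)
    have a3 := two_mul_tri j
    push_cast at a1 a2 ⊢
    linarith
  rw [e, pow_add, neg_pow (x * z), mul_pow, neg_pow z j]
  ring

theorem fb_of_le (x z : R) (c m d i j : ℕ) (hm : i + j = m) :
    fb x z (c + m + d) c (c + m) (c + i)
      = (-z) ^ d * qz (tri (c + m) - tri (c + m + d)) * qf (d + m) *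
        ((-(x * z * qz 1)) ^ j * qz (tri j) * iq j * iq i * iq (d + j)) := by
  subst hm
  rw [fb, iz_add, show c + (i + j) + d = c + i + (d + j) by omega,
    show c + (i + j) = c + i + j by omega, iz_add, iz_add,
    show c + i + (d + j) - (c + i) = d + j by omega, show c + i + j - (c + i) = j by omega,
    show c + i + (d + j) - c = d + (i + j) by omega, ← neg_mul, mul_pow, qz_pow]
  have e : (qz (tri (c + i) - tri (c + i + (d + j)) +
      (((c + i + j : ℕ) : ℤ) ^ 2 - (c + i + j : ℕ) * (c + i : ℕ))) : R)
      = qz (tri (c + i + j) - tri (c + i + (d + j))) * (qz (1 * j) * qz (tri j)) := by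
    rw [← qz_add, ← qz_add]
    congr 1
    have a1 := two_mul_tri (c + i + j)
    have a2 := two_mul_tri (c + i)
    have a3 := two_mul_tri j
    push_cast at a1 a2 ⊢
    linarith
  rw [e, pow_add, neg_pow (x * z), mul_pow, neg_pow z j]
  ring

theorem fb_of_ge (x z : R) (c m d i j : ℕ) (hm : i + j = m) :
    fb x z (c + m) c (c + m + d) (c + i)
      = x ^ d * qz (((c + m + d : ℕ) : ℤ) ^ 2 - (c + m + d : ℕ) * (c + m : ℕ)) * qf m *
        ((-(x * z * qz (d + 1))) ^ j * qz (tri j) * iq j * iq i * iq (d + j)) := by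
  subst hm
  rw [fb, iz_add, show c + (i + j) + d = c + i + (d + j) by omega,
    show c + (i + j) = c + i + j by omega, iz_add, iz_add,
    show c + i + (d + j) - (c + i) = d + j by omega, show c + i + j - (c + i) = j by omega,
    show c + i + j - c = i + j by omega, ← neg_mul, mul_pow, qz_pow]
  have e : (qz (tri (c + i) - tri (c + i + j) +
      (((c + i + (d + j) : ℕ) : ℤ) ^ 2 - (c + i + (d + j) : ℕ) * (c + i : ℕ))) : R)
      = qz (((c + i + (d + j) : ℕ) : ℤ) ^ 2 - (c + i + (d + j) : ℕ) * (c + i + j : ℕ)) *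
        (qz ((d + 1) * j) * qz (tri j)) := by
    rw [← qz_add, ← qz_add]
    congr 1
    have a1 := two_mul_tri (c + i + j)
    have a2 := two_mul_tri (c + i)
    have a3 := two_mul_tri j
    push_cast at a1 a2 ⊢
    linarith
  rw [e, pow_add, neg_pow (x * z), mul_pow, neg_pow z j]
  ring

variable {N M : ℕ} {x z : R} {κ κ' lam : ℕ}

/-- The telescoping factor. -/
noncomputable def eh (N : ℕ) (u : R) (n : ℕ) : R := ex N (u * qz (n + 1)) * qf n

theorem level_first (hx : x ^ N = 0) (hκ : κ' ≤ κ) (hl : κ' ≤ lam)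
    (hM : κ + 2 * N ≤ M) (hM' : lam < M) :
    ∑ k ∈ range M, fa x z κ κ' lam k
      = eh N (x * z) (lam - κ') * ∑ k ∈ range M, fb x z κ κ' lam k := by
  rcases le_total lam κ with h | h
  · obtain ⟨m, rfl⟩ := Nat.exists_eq_add_of_le hl
    obtain ⟨d, rfl⟩ := Nat.exists_eq_add_of_le h
    rw [sum_upper (v := x * z * qz 1) (by rw [mul_pow, mul_pow, hx]; simp) (by omega)
      (fun k h => fa_eq_zero_of_lt_left x z h) (fa_of_le x z κ' m d)]
    have h2 := sum_lower (M := M) (f' := fb x z (κ' + m + d) κ' (κ' + m)) (by omega) (fun k h => fb_eq_zero_of_lt x z h)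
      (fun k h => fb_eq_zero_of_lt_right x z h)
      (fb_of_le x z κ' m d)
    have h3 : (qf (d + m) : R) * iq (d + m) = 1 := qf_mul_iq _
    have h4 : (qf m : R) * iq m = 1 := qf_mul_iq _
    have e1 : x * z * qz 1 * qz m = x * z * qz (m + 1) := by rw [mul_assoc, ← qz_add, add_comm]
    rw [eh, show κ' + m - κ' = m by omega, e1]
    refine (isUnit_qf (d + m)).mul_left_cancel ?_
    linear_combination (- ex N (x * z * qz (m + 1)) * qf m) * h2 -
      (qf (d + m) * ((-z) ^ d * qz (tri (κ' + m) - tri (κ' + m + d))) *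
        ex N (x * z * qz (m + 1)) * sp m (x * z * qz 1) (qz (d + 1)) 0) * h4
  · rcases le_or_gt N (lam - κ) with hd | hd
    · have h0 : ∀ n, N ≤ n → x ^ n = 0 := fun n hn => pow_eq_zero_of_le hn hx
      rw [sum_eq_zero, sum_eq_zero, mul_zero]
      · intro k _
        rcases lt_or_ge κ k with hk | hk
        · exact fb_eq_zero_of_lt_left x z hk
        · simp [fb, h0 (lam - k) (by omega)]
      · intro k _
        rcases lt_or_ge k lam with hk | hk
        · exact fa_eq_zero_of_lt_right x z hk
        · simp [fa, h0 (k - κ) (by omega)]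
    obtain ⟨m, rfl⟩ := Nat.exists_eq_add_of_le hκ
    obtain ⟨d, rfl⟩ := Nat.exists_eq_add_of_le h
    rw [sum_upper (v := x * z * qz (d + 1)) (by rw [mul_pow, mul_pow, hx]; simp) (by omega)
      (fun k h => fa_eq_zero_of_lt_right x z h) (fa_of_ge x z κ' m d)]
    have h2 := sum_lower (M := M) (f' := fb x z (κ' + m) κ' (κ' + m + d)) (by omega) (fun k h => fb_eq_zero_of_lt x z h)
      (fun k h => fb_eq_zero_of_lt_left x z h)
      (fb_of_ge x z κ' m d)
    have h4 : (qf m : R) * iq m = 1 := qf_mul_iq _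
    have e1 : x * z * qz (d + 1) * qz m = x * z * qz (((d + m : ℕ) : ℤ) + 1) := by
      rw [mul_assoc, ← qz_add]; congr 2; push_cast; ring
    rw [eh, show κ' + m + d - κ' = d + m by omega, e1]
    linear_combination (- ex N (x * z * qz ((d + m : ℕ) + 1))) * h2 -
      ((x ^ d * qz (((κ' + m + d : ℕ) : ℤ) ^ 2 - (κ' + m + d : ℕ) * (κ' + m : ℕ))) *
        ex N (x * z * qz ((d + m : ℕ) + 1)) *
        sp m (x * z * qz (d + 1)) (qz (d + 1)) 0) * h4

theorem level_next (hN : 0 < N) (hx : x ^ N = 0) {lam' : ℕ} (hκ : κ' ≤ κ) (hl : κ' ≤ lam)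
    (hl' : lam ≤ lam') (hκl : κ ≤ lam') (hM : lam' < M) :
    eh N (x * z) (lam' - κ) * ∑ k ∈ range M, fa x z κ κ' lam k * iz lam' k
      = eh N (x * z) (lam - κ') *
        ∑ k ∈ range M, fb x z κ κ' lam k * (iz lam' lam * qf (lam' - k)) := by
  have hcomm : ∑ k ∈ range M, fb x z κ κ' lam k * (iz lam' lam * qf (lam' - k))
      = iz lam' lam * ∑ k ∈ range M, fb x z κ κ' lam k * qf (lam' - k) := by
    rw [mul_sum]
    exact sum_congr rfl fun k _ => by ring
  rw [hcomm]
  rcases le_total lam κ with h | h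
  · obtain ⟨m, rfl⟩ := Nat.exists_eq_add_of_le hl
    obtain ⟨d, rfl⟩ := Nat.exists_eq_add_of_le h
    obtain ⟨n, rfl⟩ := Nat.exists_eq_add_of_le hκl
    have hv : (x * z * qz 1) ^ N = 0 := by rw [mul_pow, mul_pow, hx]; simp
    have key := ex_mul_sd hN hv d n m
    rw [sum_upper_mul_iz hM (fun k h => fa_eq_zero_of_lt_left x z h) (fa_of_le x z κ' m d),
      sum_lower_mul_qf (M := M) (f' := fb x z (κ' + m + d) κ' (κ' + m)) n (by omega) (fun k h => fb_eq_zero_of_lt x z h)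
      (fun k h => fb_eq_zero_of_lt_right x z h)
      (fb_of_le x z κ' m d)]
    have h2 : (qf n : R) * iq n = 1 := qf_mul_iq _
    have h3 : (qf (d + n) : R) * iq (d + n) = 1 := qf_mul_iq _
    have h4 : (qf m : R) * iq m = 1 := qf_mul_iq _
    have e1 : ∀ m : ℕ, x * z * qz 1 * qz m = x * z * qz (m + 1) := fun m => by
      rw [mul_assoc, ← qz_add, add_comm]
    rw [e1, e1] at key
    rw [eh, eh, show κ' + m - κ' = m by omega, show κ' + m + d + n - (κ' + m + d) = n by omega,
      show κ' + m + d + n = κ' + m + (d + n) by omega, iz_add]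
    refine (isUnit_qf (d + n)).mul_left_cancel ?_
    generalize ex N (x * z * qz (n + 1)) = a at *
    generalize ex N (x * z * qz (m + 1)) = b at *
    generalize sd n m (x * z * qz 1) (qz (d + 1)) = s at *
    generalize sd m n (x * z * qz 1) (qz (d + 1)) = s' at *
    generalize (-z) ^ d * qz (tri (κ' + m) - tri (κ' + m + d)) = C
    linear_combination C * key + qf (d + n) * a * C * s * h2 - b * C * qf (d + m) * s' *
      (qf m * iq m * h3 + h4)
  · obtain ⟨m, rfl⟩ := Nat.exists_eq_add_of_le hκ
    obtain ⟨d, rfl⟩ := Nat.exists_eq_add_of_le h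
    obtain ⟨n, rfl⟩ := Nat.exists_eq_add_of_le hl'
    have hv : (x * z * qz (d + 1)) ^ N = 0 := by rw [mul_pow, mul_pow, hx]; simp
    have key := ex_mul_sd hN hv d n m
    rw [sum_upper_mul_iz hM (fun k h => fa_eq_zero_of_lt_right x z h) (fa_of_ge x z κ' m d),
      sum_lower_mul_qf (M := M) (f' := fb x z (κ' + m) κ' (κ' + m + d)) n (by omega) (fun k h => fb_eq_zero_of_lt x z h)
      (fun k h => fb_eq_zero_of_lt_left x z h)
      (fb_of_ge x z κ' m d)]
    have h4 : (qf m : R) * iq m = 1 := qf_mul_iq _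
    have e1 : ∀ m : ℕ, x * z * qz (d + 1) * qz m = x * z * qz (((d + m : ℕ) : ℤ) + 1) :=
      fun m => by rw [mul_assoc, ← qz_add]; congr 2; push_cast; ring
    rw [e1, e1] at key
    rw [eh, eh, show κ' + m + d - κ' = d + m by omega,
      show κ' + m + d + n - (κ' + m) = d + n by omega, iz_add]
    generalize ex N (x * z * qz ((d + n : ℕ) + 1)) = a at *
    generalize ex N (x * z * qz ((d + m : ℕ) + 1)) = b at *
    generalize sd n m (x * z * qz (d + 1)) (qz (d + 1)) = s at *
    generalize sd m n (x * z * qz (d + 1)) (qz (d + 1)) = s' at *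
    generalize x ^ d * qz (((κ' + m + d : ℕ) : ℤ) ^ 2 - (κ' + m + d : ℕ) * (κ' + m : ℕ)) = C
    linear_combination C * iq n * key - b * qf (d + m) * C * s' * iq n * h4

end UE

section UEGlobal

variable {T N : ℕ} {x z : R} {κ lam : ℕ → ℕ}

/-- Rows that are small enough for truncation at `T` to be harmless. -/
def Small (T N : ℕ) (κ : ℕ → ℕ) : Prop := ∑ t ∈ range T, κ t + 2 * N ≤ T

theorem uk_mul_ek_eq_zero (hx : x ^ N = 0) (h : ∑ t ∈ range T, κ t + N ≤ ∑ t ∈ range T, lam t)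
    (ν : ℕ → ℕ) : uk T x κ ν * ek T z ν lam = 0 := by
  by_cases hlt : ∃ t ∈ range T, ν t < lam t
  · obtain ⟨t, ht, h⟩ := hlt
    rw [ek, prod_eq_zero ht, mul_zero]
    simp [iz_of_lt h]
  · push Not at hlt
    have : ∏ t ∈ range T, x ^ (ν t - κ t) = 0 := by
      refine prod_pow_eq_zero (ν := fun t => ν t - κ t) hx ?_
      have h1 : ∑ t ∈ range T, lam t ≤ ∑ t ∈ range T, ((ν t - κ t) + κ t) :=
        sum_le_sum fun t ht => by have := hlt t ht; omega
      rw [sum_add_distrib] at h1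
      omega
    simp only [uk, prod_mul_distrib, this, zero_mul]

theorem ek_mul_uk_eq_zero (hx : x ^ N = 0) (h : ∑ t ∈ range T, κ t + N ≤ ∑ t ∈ range T, lam t)
    (τ : ℕ → ℕ) : ek T z κ τ * uk T x τ lam = 0 := by
  by_cases hlt : ∃ t ∈ range T, κ t < τ t
  · obtain ⟨t, ht, h⟩ := hlt
    rw [ek, prod_eq_zero ht, zero_mul]
    simp [iz_of_lt h]
  · push Not at hlt
    have : ∏ t ∈ range T, x ^ (lam t - τ t) = 0 := by
      refine prod_pow_eq_zero (ν := fun t => lam t - τ t) hx ?_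
      have h1 : ∑ t ∈ range T, lam t ≤ ∑ t ∈ range T, ((lam t - τ t) + κ t) :=
        sum_le_sum fun t ht => by have := hlt t ht; omega
      rw [sum_add_distrib] at h1
      omega
    simp only [uk, prod_mul_distrib, this, zero_mul, mul_zero]

theorem sum_uk_mul_ek_eq_prod :
    ∑ r ∈ box T, uk T x κ r * ek T z r lam
      = (∏ t ∈ range T, ∑ k ∈ range (T + 1), fa x z (κ t) (κ (t + 1)) (lam t) k *
          lag (fun t k => iz (lam t) k) t k) * lag (fun t k => (iz (lam t) k : R)) T 0 := by
  rw [← sum_box_prod_lag T (fun t k => fa x z (κ t) (κ (t + 1)) (lam t) k) _ lam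
    (fun t k h => fa_eq_zero_of_lt_right x z h)
    (fun t k h => by rw [iz_of_lt h, mul_zero])]
  refine sum_congr rfl fun r hr => ?_
  rw [uk, ek, ← prod_mul_distrib]
  refine prod_congr rfl fun t _ => ?_
  rw [fa, qz_add]
  linear_combination (x ^ (r t - κ t) * qz ((r t : ℤ) ^ 2 - r t * κ t) * qf (r t - κ (t + 1)) *
    iz (r t) (κ t) * ((-z) ^ (r t - lam t) * qz (tri (lam t) - tri (r t)) *
    iz (r t) (lam t) * iz (lam t) (r (t + 1)))) * qf_mul_iz (R := R) (succ_le_of_mem_box hr t)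

theorem sum_ek_mul_uk_eq_prod (hl : lam ∈ box T) :
    ∑ r ∈ box T, ek T z κ r * uk T x r lam
      = ∏ t ∈ range T, ∑ k ∈ range (T + 1), fb x z (κ t) (κ (t + 1)) (lam t) k *
          lag (fun t k => iz (lam t) (lam (t + 1)) * qf (lam t - k)) t k := by
  have h1 : lag (fun t k => (iz (lam t) (lam (t + 1)) * qf (lam t - k) : R)) T 0 = 1 := by
    cases T with
    | zero => rfl
    | succ S =>
      simp only [lag]
      rw [eq_zero_of_mem_box hl le_rfl, mul_comm, qf_mul_iz (Nat.zero_le _)]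
  rw [← mul_one (∏ t ∈ range T, _), ← h1,
    ← sum_box_prod_lag T (fun t k => fb x z (κ t) (κ (t + 1)) (lam t) k) _ (fun t => κ (t + 1))
    (fun t k h => fb_eq_zero_of_lt x z h)
    (fun t k h => by rw [fb_eq_zero_of_lt_left x z h, zero_mul])]
  refine sum_congr rfl fun r _ => ?_
  rw [uk, ek, ← prod_mul_distrib]
  refine prod_congr rfl fun t _ => ?_
  rw [fb, qz_add]
  ring

theorem sum_uk_mul_ek (hN : 0 < N) (hx : x ^ N = 0) (hκ : κ ∈ box T) (hl : lam ∈ box T)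
    (hs : Small T N κ) :
    ∑ r ∈ box T, uk T x κ r * ek T z r lam
      = gi N (x * z) * ∑ r ∈ box T, ek T z κ r * uk T x r lam := by
  unfold Small at hs
  obtain ⟨S, rfl⟩ := Nat.exists_eq_succ_of_ne_zero (show T ≠ 0 by omega)
  simp only [Nat.succ_eq_add_one] at *
  by_cases hS : lam S = 0
  swap
  · have h := le_sum_of_mem_box hl hS
    rw [sum_eq_zero fun r _ => uk_mul_ek_eq_zero hx (by omega) r,
      sum_eq_zero fun r _ => ek_mul_uk_eq_zero hx (by omega) r, mul_zero]
  rw [sum_uk_mul_ek_eq_prod, sum_ek_mul_uk_eq_prod hl]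
  have hκ0 : κ 0 + 2 * N ≤ S + 1 := by
    have := single_le_sum (f := κ) (fun t _ => Nat.zero_le (κ t))
      (mem_range.2 (show 0 < S + 1 by omega))
    omega
  by_cases hex : ∃ t < S, lam t < κ (t + 1)
  · obtain ⟨t, ht, h⟩ := hex
    rw [prod_eq_zero (mem_range.2 (show t + 1 < S + 1 by omega)),
      prod_eq_zero (mem_range.2 (show t < S + 1 by omega)), zero_mul, mul_zero]
    · refine sum_eq_zero fun k _ => ?_
      rcases lt_or_ge k (κ (t + 1)) with hk | hk
      · rw [fb_eq_zero_of_lt x z hk, zero_mul]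
      · rw [fb_eq_zero_of_lt_right x z (show lam t < k by omega), zero_mul]
    · refine sum_eq_zero fun k _ => ?_
      rcases lt_or_ge k (κ (t + 1)) with hk | hk
      · rw [fa_eq_zero_of_lt_left x z hk, zero_mul]
      · simp only [lag]
        rw [iz_of_lt (show lam t < k by omega), mul_zero]
  · push Not at hex
    have hle : ∀ t ≤ S, κ (t + 1) ≤ lam t := by
      intro t ht
      rcases ht.lt_or_eq with h | rfl
      · exact hex t h
      · rw [eq_zero_of_mem_box hκ le_rfl]
        exact Nat.zero_le _
    have key : ∀ m ≤ S, ∏ t ∈ range (m + 1), ∑ k ∈ range (S + 1 + 1),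
          fa x z (κ t) (κ (t + 1)) (lam t) k * lag (fun t k => iz (lam t) k) t k
        = eh N (x * z) (lam m - κ (m + 1)) * ∏ t ∈ range (m + 1), ∑ k ∈ range (S + 1 + 1),
          fb x z (κ t) (κ (t + 1)) (lam t) k *
            lag (fun t k => iz (lam t) (lam (t + 1)) * qf (lam t - k)) t k := by
      intro m
      induction m with
      | zero =>
        intro _
        have := le_of_mem_box hl 0
        simp only [zero_add, prod_range_one, lag, mul_one]
        exact level_first hx (succ_le_of_mem_box hκ 0) (hle 0 (by omega)) (by omega) (by omega)
      | succ m ih =>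
        intro hm
        have h1 := le_of_mem_box hl m
        rw [prod_range_succ, ih (by omega), prod_range_succ _ (m + 1)]
        have := level_next (z := z) (M := S + 1 + 1) hN hx (succ_le_of_mem_box hκ (m + 1))
          (hle (m + 1) hm) (succ_le_of_mem_box hl m) (hle m (by omega)) (by omega)
        simp only [lag_succ]
        linear_combination (∏ t ∈ range (m + 1), ∑ k ∈ range (S + 1 + 1),
          fb x z (κ t) (κ (t + 1)) (lam t) k *
            lag (fun t k => iz (lam t) (lam (t + 1)) * qf (lam t - k)) t k) * this
    rw [key S le_rfl, eq_zero_of_mem_box hκ (le_refl (S + 1)), hS]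
    simp [lag, hS, eh, gi]

theorem sum_dk_mul_uk (hN : 0 < N) (hx : x ^ N = 0) (hκ : κ ∈ box T) (hl : lam ∈ box T)
    (hs : Small T N κ) :
    ∑ r ∈ box T, dk T z κ r * uk T x r lam
      = gi N (x * z) * ∑ r ∈ box T, uk T x κ r * dk T z r lam := by
  classical
  have hrow : ∀ r : box T, Small T N r → ∀ s : box T,
      (mat T (uk T x) * mat T (ek T z)) r s
        = (gi N (x * z) • (mat T (ek T z) * mat T (uk T x))) r s := by
    intro r hr s
    rw [Matrix.smul_apply, mat_mul_apply, mat_mul_apply, sum_uk_mul_ek hN hx r.2 s.2 hr,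
      smul_eq_mul]
  have hsub : ∀ r : box T, mat T (dk T z) ⟨κ, hκ⟩ r ≠ 0 → Small T N r := by
    intro r hr
    unfold Small at hs ⊢
    have : ∑ t ∈ range T, (r : ℕ → ℕ) t ≤ ∑ t ∈ range T, κ t := by
      refine sum_le_sum fun t ht => ?_
      by_contra hlt
      refine hr (prod_eq_zero ht ?_)
      simp [iz_of_lt (show κ t < (r : ℕ → ℕ) t by omega)]
    omega
  have h1 : (mat T (dk T z) * (mat T (uk T x) * mat T (ek T z))) ⟨κ, hκ⟩
      = (mat T (dk T z) * (gi N (x * z) • (mat T (ek T z) * mat T (uk T x)))) ⟨κ, hκ⟩ := by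
    funext s
    rw [Matrix.mul_apply, Matrix.mul_apply]
    refine sum_congr rfl fun r _ => ?_
    by_cases hr : mat T (dk T z) ⟨κ, hκ⟩ r = 0
    · rw [hr, zero_mul, zero_mul]
    · rw [hrow r (hsub r hr)]
  have h2 : ((mat T (dk T z) * (mat T (uk T x) * mat T (ek T z))) * mat T (dk T z)) ⟨κ, hκ⟩
      = ((mat T (dk T z) * (gi N (x * z) • (mat T (ek T z) * mat T (uk T x)))) *
        mat T (dk T z)) ⟨κ, hκ⟩ := by
    funext s
    rw [Matrix.mul_apply, Matrix.mul_apply, h1]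
  have e1 : (mat T (dk T z) * (mat T (uk T x) * mat T (ek T z))) * mat T (dk T z)
      = mat T (dk T z) * mat T (uk T x) := by
    rw [mul_assoc, mul_assoc, mat_ek_mul_dk, mul_one]
  have e2 : (mat T (dk T z) * (gi N (x * z) • (mat T (ek T z) * mat T (uk T x)))) * mat T (dk T z)
      = gi N (x * z) • (mat T (uk T x) * mat T (dk T z)) := by
    rw [mul_smul_comm, smul_mul_assoc, ← mul_assoc, mat_dk_mul_ek, one_mul]
  rw [e1, e2] at h2
  have := congrFun h2 ⟨lam, hl⟩
  rwa [Matrix.smul_apply, mat_mul_apply, mat_mul_apply, smul_eq_mul] at this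

end UEGlobal

/-! ### Doubling of sequences -/

/-- The sequence in which every entry of `ρ` is repeated twice. -/
def dbl (ρ : ℕ → ℕ) : ℕ → ℕ := fun t => ρ (t / 2)

theorem prod_range_two_mul {A : Type*} [CommMonoid A] (g : ℕ → A) (n : ℕ) :
    ∏ t ∈ range (2 * n), g t = ∏ s ∈ range n, (g (2 * s) * g (2 * s + 1)) := by
  induction n with
  | zero => simp
  | succ n ih => rw [mul_add_one, prod_range_succ, prod_range_succ, ih, prod_range_succ, mul_assoc]

theorem sum_dbl_le (ρ : ℕ → ℕ) (T : ℕ) :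
    ∑ t ∈ range T, dbl ρ t ≤ 2 * ∑ t ∈ range T, ρ t := by
  have h1 : ∑ t ∈ range T, dbl ρ t ≤ ∑ t ∈ range (2 * T), dbl ρ t :=
    sum_le_sum_of_subset (range_mono (by omega))
  refine h1.trans (le_of_eq ?_)
  clear h1
  induction T with
  | zero => simp
  | succ T ih =>
    rw [mul_add_one, sum_range_succ, sum_range_succ, ih, sum_range_succ]
    simp only [dbl]
    rw [show 2 * T / 2 = T by omega, show (2 * T + 1) / 2 = T by omega]
    ring

section Doubling

variable {T N : ℕ} {y z : R} {ρ ν : ℕ → ℕ}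

theorem dbl_mem_box_of_sum_lt (hT : 4 * N ≤ T) (hρ : ρ ∈ box T) (h : ∑ t ∈ range T, ρ t < N) :
    dbl ρ ∈ box T := by
  refine mem_box.2 ⟨fun a b hab => antitone_of_mem_box hρ (Nat.div_le_div_right hab),
    le_of_mem_box hρ _, fun t ht => ?_⟩
  by_contra hne
  have hlt : t / 2 < T := by
    by_contra hge
    exact hne (eq_zero_of_mem_box hρ (by omega))
  have h1 : ∑ s ∈ range (t / 2 + 1), 1 ≤ ∑ s ∈ range (t / 2 + 1), ρ s := by
    refine sum_le_sum fun s hs => ?_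
    have := antitone_of_mem_box hρ (show s ≤ t / 2 by rw [mem_range] at hs; omega)
    have : ρ (t / 2) ≠ 0 := hne
    omega
  have h2 : ∑ s ∈ range (t / 2 + 1), ρ s ≤ ∑ s ∈ range T, ρ s :=
    sum_le_sum_of_subset (range_mono (by omega))
  rw [sum_const, card_range, smul_eq_mul, mul_one] at h1
  omega

theorem small_dbl_of_sum_lt (hT : 4 * N ≤ T) (h : ∑ t ∈ range T, ρ t < N) :
    Small T N (dbl ρ) := by
  have := sum_dbl_le ρ T
  unfold Small
  omega

theorem kk_eq_zero (hy : y ^ N = 0) (h : N ≤ ∑ t ∈ range T, ρ t) (μ : ℕ → ℕ) :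
    kk T y μ ρ = 0 := by
  simp only [kk, prod_mul_distrib, prod_pow_eq_zero hy h, zero_mul]

theorem mem_box_even (hν : ν ∈ box T) : (fun t => ν (2 * t)) ∈ box T :=
  mem_box.2 ⟨fun a b hab => antitone_of_mem_box hν (by omega), le_of_mem_box hν _,
    fun t ht => eq_zero_of_mem_box hν (by omega)⟩

theorem mem_box_odd (hν : ν ∈ box T) : (fun t => ν (2 * t + 1)) ∈ box T :=
  mem_box.2 ⟨fun a b hab => antitone_of_mem_box hν (by omega), le_of_mem_box hν _,
    fun t ht => eq_zero_of_mem_box hν (by omega)⟩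

/-- The common factor of the two sides of the doubling identity. -/
noncomputable def ck (T : ℕ) (z : R) (ν : ℕ → ℕ) : R :=
  ∏ s ∈ range T, (z ^ (ν (2 * s) - ν (2 * s + 1)) * qz ((ν (2 * s + 1) : ℤ) ^ 2) *
    iz (ν (2 * s)) (ν (2 * s + 1)) * iz (ν (2 * s + 1)) (ν (2 * s + 2)) *
    qf (ν (2 * s) - ν (2 * s + 2)))

theorem dk_dbl (hν : ν ∈ box T) (hd : dbl ρ ∈ box T) :
    dk T z (dbl ρ) ν = ∏ s ∈ range T, ((z ^ (ρ s - ν (2 * s)) *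
      qz ((ν (2 * s) : ℤ) ^ 2 - ν (2 * s) * ρ s) * qf (ρ s - ν (2 * s + 1)) *
      iz (ν (2 * s)) (ν (2 * s + 1)) * iz (ρ s) (ν (2 * s))) * (z ^ (ρ s - ν (2 * s + 1)) *
      qz ((ν (2 * s + 1) : ℤ) ^ 2 - ν (2 * s + 1) * ρ s) * qf (ρ s - ν (2 * s + 2)) *
      iz (ν (2 * s + 1)) (ν (2 * s + 2)) * iz (ρ s) (ν (2 * s + 1)))) := by
  have h : dk T z (dbl ρ) ν = dk (2 * T) z (dbl ρ) ν := by
    refine prod_subset (range_mono (by omega)) fun t _ ht => ?_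
    rw [mem_range, not_lt] at ht
    rw [eq_zero_of_mem_box hν ht, eq_zero_of_mem_box hν (by omega), eq_zero_of_mem_box hd ht]
    simp
  rw [h, dk, prod_range_two_mul]
  refine prod_congr rfl fun s _ => ?_
  simp only [dbl]
  rw [show 2 * s / 2 = s by omega, show (2 * s + 1) / 2 = s by omega]

theorem uk_dbl (x : R) (hν : ν ∈ box T) (hd : dbl ρ ∈ box T) :
    uk T x (dbl ρ) ν = ∏ s ∈ range T, ((x ^ (ν (2 * s) - ρ s) *
      qz ((ν (2 * s) : ℤ) ^ 2 - ν (2 * s) * ρ s) * qf (ν (2 * s) - ρ s) *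
      iz (ν (2 * s)) (ν (2 * s + 1)) * iz (ν (2 * s)) (ρ s)) * (x ^ (ν (2 * s + 1) - ρ s) *
      qz ((ν (2 * s + 1) : ℤ) ^ 2 - ν (2 * s + 1) * ρ s) * qf (ν (2 * s + 1) - ρ (s + 1)) *
      iz (ν (2 * s + 1)) (ν (2 * s + 2)) * iz (ν (2 * s + 1)) (ρ s))) := by
  have h : uk T x (dbl ρ) ν = uk (2 * T) x (dbl ρ) ν := by
    refine prod_subset (range_mono (by omega)) fun t _ ht => ?_
    rw [mem_range, not_lt] at ht
    rw [eq_zero_of_mem_box hν ht, eq_zero_of_mem_box hν (by omega), eq_zero_of_mem_box hd ht]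
    simp
  rw [h, uk, prod_range_two_mul]
  refine prod_congr rfl fun s _ => ?_
  simp only [dbl]
  rw [show 2 * s / 2 = s by omega, show (2 * s + 1) / 2 = s by omega,
    show (2 * s + 1 + 1) / 2 = s + 1 by omega]

theorem kk_mul_dk_dbl (hν : ν ∈ box T) (hd : dbl ρ ∈ box T) :
    kk T y 0 ρ * dk T z (dbl ρ) ν
      = ck T z ν * (kk T y (fun t => ν (2 * t + 1)) ρ * dk T (z ^ 2) ρ fun t => ν (2 * t)) := by
  rw [dk_dbl hν hd, ck, kk, kk, dk, ← prod_mul_distrib, ← prod_mul_distrib, ← prod_mul_distrib]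
  refine prod_congr rfl fun s _ => ?_
  have h1 := succ_le_of_mem_box hν (2 * s)
  have h2 := succ_le_of_mem_box hν (2 * s + 1)
  simp only [mul_add_one, Pi.zero_apply, Nat.cast_zero, mul_zero, sub_zero]
  generalize ν (2 * s) = a at *
  generalize ν (2 * s + 1) = b at *
  generalize ν (2 * s + 1 + 1) = a' at *
  rcases lt_or_ge (ρ s) a with h | h
  · simp [iz_of_lt h]
  · have e1 : (qf (ρ s - b) : R) * iz (ρ s) b = 1 := qf_mul_iz (by omega)
    have e2 : (qf (a - a') : R) * iz a a' = 1 := qf_mul_iz (by omega)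
    have e3 : (qz ((ρ s : ℤ) ^ 2) * qz ((b : ℤ) ^ 2 - b * ρ s) : R)
        = qz ((b : ℤ) ^ 2) * qz ((ρ s : ℤ) ^ 2 - ρ s * b) := by
      rw [← qz_add, ← qz_add]; congr 1; ring
    have e4 : z ^ (ρ s - a) * z ^ (ρ s - b) = z ^ (a - b) * (z ^ 2) ^ (ρ s - a) := by
      rw [← pow_mul, ← pow_add, ← pow_add]; congr 1; omega
    calc _ = (z ^ (ρ s - a) * z ^ (ρ s - b)) * (qz ((ρ s : ℤ) ^ 2) * qz ((b : ℤ) ^ 2 - b * ρ s)) *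
          (qf (ρ s - b) * iz (ρ s) b) * (y ^ ρ s * iz (ρ s) (ρ (s + 1)) * qz ((a : ℤ) ^ 2 - a * ρ s)
          * iz a b * iz (ρ s) a * qf (ρ s - a') * iz b a') := by ring
      _ = (z ^ (a - b) * (z ^ 2) ^ (ρ s - a)) * (qz ((b : ℤ) ^ 2) * qz ((ρ s : ℤ) ^ 2 - ρ s * b)) *
          (qf (a - a') * iz a a') * (y ^ ρ s * iz (ρ s) (ρ (s + 1)) * qz ((a : ℤ) ^ 2 - a * ρ s)
          * iz a b * iz (ρ s) a * qf (ρ s - a') * iz b a') := by rw [e1, e2, e3, e4]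
      _ = _ := by ring

theorem kk_mul_uk_dbl (hν : ν ∈ box T) (hd : dbl ρ ∈ box T) :
    kk T y 0 ρ * uk T (y * z) (dbl ρ) ν
      = ck T z ν * (dk T (y * z ^ 2) (fun t => ν (2 * t + 1)) ρ * kk T y ρ fun t => ν (2 * t)) := by
  rw [uk_dbl _ hν hd, ck, kk, kk, dk, ← prod_mul_distrib, ← prod_mul_distrib, ← prod_mul_distrib]
  refine prod_congr rfl fun s _ => ?_
  have h1 := succ_le_of_mem_box hν (2 * s)
  have h2 := succ_le_of_mem_box hν (2 * s + 1)
  simp only [mul_add_one, Pi.zero_apply, Nat.cast_zero, mul_zero, sub_zero]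
  generalize ν (2 * s) = a at *
  generalize ν (2 * s + 1) = b at *
  generalize ν (2 * s + 1 + 1) = a' at *
  rcases lt_or_ge b (ρ s) with h | h
  · simp [iz_of_lt h]
  · have e1 : (qf (a - ρ s) : R) * iz a (ρ s) = 1 := qf_mul_iz (by omega)
    have e2 : (qf (a - a') : R) * iz a a' = 1 := qf_mul_iz (by omega)
    have e3 : (qz ((ρ s : ℤ) ^ 2) * qz ((b : ℤ) ^ 2 - b * ρ s) : R)
        = qz ((b : ℤ) ^ 2) * qz ((ρ s : ℤ) ^ 2 - ρ s * b) := by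
      rw [← qz_add, ← qz_add]; congr 1; ring
    have e4 : y ^ ρ s * ((y * z) ^ (a - ρ s) * (y * z) ^ (b - ρ s))
        = z ^ (a - b) * (y * z ^ 2) ^ (b - ρ s) * y ^ a := by
      obtain ⟨i, rfl⟩ := Nat.exists_eq_add_of_le h
      obtain ⟨j, rfl⟩ := Nat.exists_eq_add_of_le h1
      rw [show ρ s + i + j - ρ s = i + j by omega, show ρ s + i - ρ s = i by omega,
        show ρ s + i + j - (ρ s + i) = j by omega]
      ring
    calc _ = (y ^ ρ s * ((y * z) ^ (a - ρ s) * (y * z) ^ (b - ρ s))) *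
          (qz ((ρ s : ℤ) ^ 2) * qz ((b : ℤ) ^ 2 - b * ρ s)) *
          (qf (a - ρ s) * iz a (ρ s)) * (iz (ρ s) (ρ (s + 1)) * qz ((a : ℤ) ^ 2 - a * ρ s)
          * iz a b * iz b (ρ s) * qf (b - ρ (s + 1)) * iz b a') := by ring
      _ = (z ^ (a - b) * (y * z ^ 2) ^ (b - ρ s) * y ^ a) *
          (qz ((b : ℤ) ^ 2) * qz ((ρ s : ℤ) ^ 2 - ρ s * b)) *
          (qf (a - a') * iz a a') * (iz (ρ s) (ρ (s + 1)) * qz ((a : ℤ) ^ 2 - a * ρ s)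
          * iz a b * iz b (ρ s) * qf (b - ρ (s + 1)) * iz b a') := by rw [e1, e2, e3, e4]
      _ = _ := by ring

theorem sum_kk_mul_dk_dbl (hy : y ^ N = 0) (hT : 4 * N ≤ T) (hν : ν ∈ box T) :
    gi N (y * z ^ 2) * ∑ r ∈ box T, kk T y 0 r * dk T z (dbl r) ν
      = ∑ r ∈ box T, kk T y 0 r * uk T (y * z) (dbl r) ν := by
  have h1 : ∀ r ∈ box T, kk T y 0 r * dk T z (dbl r) ν
      = ck T z ν * (kk T y (fun t => ν (2 * t + 1)) r * dk T (z ^ 2) r fun t => ν (2 * t)) := by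
    intro r hr
    rcases lt_or_ge (∑ t ∈ range T, r t) N with h | h
    · exact kk_mul_dk_dbl hν (dbl_mem_box_of_sum_lt hT hr h)
    · rw [kk_eq_zero hy h, kk_eq_zero hy h]
      ring
  have h2 : ∀ r ∈ box T, kk T y 0 r * uk T (y * z) (dbl r) ν
      = ck T z ν *
        (dk T (y * z ^ 2) (fun t => ν (2 * t + 1)) r * kk T y r fun t => ν (2 * t)) := by
    intro r hr
    by_cases hd : dbl r ∈ box T
    · exact kk_mul_uk_dbl hν hd
    · rcases lt_or_ge (∑ t ∈ range T, r t) N with h | h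
      · exact absurd (dbl_mem_box_of_sum_lt hT hr h) hd
      · rw [kk_eq_zero hy h]
        obtain ⟨t, ht, hne⟩ : ∃ t, T ≤ t ∧ dbl r t ≠ 0 := by
          by_contra hcon
          push Not at hcon
          exact hd (mem_box.2 ⟨fun a b hab => antitone_of_mem_box hr (Nat.div_le_div_right hab),
            le_of_mem_box hr _, hcon⟩)
        have hlt : t / 2 < T := by
          by_contra hge
          exact hne (eq_zero_of_mem_box hr (by omega))
        have : dk T (y * z ^ 2) (fun t => ν (2 * t + 1)) r = 0 := by
          refine prod_eq_zero (mem_range.2 hlt) ?_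
          have h0 : ν (2 * (t / 2) + 1) = 0 := eq_zero_of_mem_box hν (by omega)
          have : (iz (ν (2 * (t / 2) + 1)) (r (t / 2)) : R) = 0 :=
            iz_of_lt (by have : r (t / 2) ≠ 0 := hne; omega)
          simp [this]
        rw [this]
        ring
  rw [sum_congr rfl h1, sum_congr rfl h2, ← mul_sum, ← mul_sum]
  have := congrFun (congrFun (mat_dk_mul_kk (z := z ^ 2) hy (show 2 * N ≤ T by omega))
    ⟨_, mem_box_odd hν⟩) ⟨_, mem_box_even hν⟩
  rw [Matrix.smul_apply, mat_mul_apply, mat_mul_apply, smul_eq_mul] at this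
  rw [this]
  ring

end Doubling

/-! ### Iterated kernels -/

section iterated

variable {N T : ℕ}

theorem eq_zero_of_mem_box_of_apply_zero {μ : ℕ → ℕ} (hμ : μ ∈ box T) (h : μ 0 = 0) : μ = 0 :=
  funext fun t => Nat.eq_zero_of_le_zero (h ▸ antitone_of_mem_box hμ (Nat.zero_le t))

theorem zero_mem_box (T : ℕ) : (0 : ℕ → ℕ) ∈ box T :=
  mem_box.2 ⟨fun _ _ _ => le_rfl, Nat.zero_le _, fun _ _ => rfl⟩

/-- The vector `D_{x₁} ⋯ D_{x_k} δ₀`. -/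
noncomputable def hk (T : ℕ) : List R → (ℕ → ℕ) → R
  | [], μ => if μ 0 = 0 then 1 else 0
  | x :: L, μ => ∑ ν ∈ box T, dk T x μ ν * hk T L ν

theorem sum_mul_hk_nil (T : ℕ) (f : (ℕ → ℕ) → R) : ∑ ν ∈ box T, f ν * hk T [] ν = f 0 := by
  rw [sum_eq_single_of_mem 0 (zero_mem_box T)]
  · simp [hk]
  · intro ν hν hne
    have : ν 0 ≠ 0 := fun h => hne (eq_zero_of_mem_box_of_apply_zero hν h)
    simp [hk, this]

theorem dk_one_zero (T : ℕ) (μ : ℕ → ℕ) : dk T (1 : R) μ 0 = 1 := by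
  refine prod_eq_one fun t _ => ?_
  simp [iz_of_le (Nat.zero_le (μ t)), qf_mul_iq]

theorem kk_zero_right (T : ℕ) (y : R) (μ : ℕ → ℕ) : kk T y μ 0 = 1 :=
  prod_eq_one fun t _ => by simp

theorem uk_zero_right (hT : 0 < T) (x : R) {κ : ℕ → ℕ} (hκ : κ ∈ box T) :
    uk T x κ 0 = if κ 0 = 0 then 1 else 0 := by
  split_ifs with h
  · rw [eq_zero_of_mem_box_of_apply_zero hκ h]
    exact prod_eq_one fun t _ => by simp
  · refine prod_eq_zero (mem_range.2 hT) ?_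
    simp [iz_of_lt (Nat.pos_of_ne_zero h)]

theorem hk_singleton_one (T : ℕ) (μ : ℕ → ℕ) : hk T [(1 : R)] μ = 1 := by
  rw [hk, sum_mul_hk_nil, dk_one_zero]

theorem prod_gi_mul_sum_kk_mul_hk {y : R} (hy : y ^ N = 0) (hT : 2 * N ≤ T) (L : List R) :
    ∀ μ ∈ box T, (L.map fun x => gi N (y * x)).prod * ∑ ν ∈ box T, kk T y μ ν * hk T L ν
      = hk T (L.map (y * ·) ++ [1]) μ := by
  induction L with
  | nil =>
    intro μ _
    rw [sum_mul_hk_nil, kk_zero_right]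
    simp [hk_singleton_one]
  | cons z L ih =>
    intro μ hμ
    have key : ∀ ν ∈ box T, ∑ r ∈ box T, dk T (y * z) μ r * kk T y r ν
        = gi N (y * z) * ∑ r ∈ box T, kk T y μ r * dk T z r ν := by
      intro ν hν
      have h := congrFun (congrFun (mat_dk_mul_kk (z := z) hy hT) ⟨μ, hμ⟩) ⟨ν, hν⟩
      rwa [Matrix.smul_apply, mat_mul_apply, mat_mul_apply] at h
    have h1 : ∀ (F G : (ℕ → ℕ) → (ℕ → ℕ) → R),
        ∑ r ∈ box T, F μ r * ∑ ν ∈ box T, G r ν * hk T L ν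
          = ∑ ν ∈ box T, (∑ r ∈ box T, F μ r * G r ν) * hk T L ν := by
      intro F G
      simp only [mul_sum, sum_mul, mul_assoc]
      exact sum_comm
    rw [List.map_cons, List.map_cons, List.cons_append, List.prod_cons, hk]
    rw [← sum_congr rfl fun r hr => congrArg (dk T (y * z) μ r * ·) (ih r hr)]
    simp only [hk, mul_left_comm _ (List.prod _)]
    rw [← mul_sum, h1, h1, sum_congr rfl fun ν hν => congrArg (· * hk T L ν) (key ν hν)]
    simp only [mul_assoc, ← mul_sum]
    ring

theorem prod_gi_mul_sum_uk_mul_hk {x : R} (hN : 0 < N) (hx : x ^ N = 0) (L : List R) :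
    ∀ κ ∈ box T, Small T N κ →
      (L.map fun x' => gi N (x * x')).prod * ∑ ν ∈ box T, uk T x κ ν * hk T L ν = hk T L κ := by
  induction L with
  | nil =>
    intro κ hκ hs
    rw [sum_mul_hk_nil, uk_zero_right (by unfold Small at hs; omega) x hκ]
    simp [hk]
  | cons z L ih =>
    intro κ hκ hs
    have h1 : ∀ (F G : (ℕ → ℕ) → (ℕ → ℕ) → R),
        ∑ r ∈ box T, F κ r * ∑ ν ∈ box T, G r ν * hk T L ν
          = ∑ ν ∈ box T, (∑ r ∈ box T, F κ r * G r ν) * hk T L ν := by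
      intro F G
      simp only [mul_sum, sum_mul, mul_assoc]
      exact sum_comm
    have h2 : ∀ r ∈ box T, dk T z κ r * hk T L r = dk T z κ r *
        ((L.map fun x' => gi N (x * x')).prod * ∑ ν ∈ box T, uk T x r ν * hk T L ν) := by
      intro r hr
      by_cases hle : ∃ t ∈ range T, κ t < r t
      · obtain ⟨t, ht, h⟩ := hle
        have : dk T z κ r = 0 := prod_eq_zero ht (by simp [iz_of_lt h])
        simp [this]
      · push Not at hle
        rw [ih r hr]
        have := sum_le_sum hle
        unfold Small at *
        omega
    rw [hk, sum_congr rfl h2, List.map_cons, List.prod_cons]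
    simp only [hk, mul_left_comm _ (List.prod _)]
    rw [← mul_sum, h1, h1,
      sum_congr rfl fun ν hν => congrArg (· * hk T L ν) (sum_dk_mul_uk (z := z) hN hx hκ hν hs)]
    simp only [mul_assoc, ← mul_sum]
    ring

/-- The product of `gi N (y x x')` over unordered pairs of entries of a list. -/
noncomputable def pairProd (N : ℕ) (y : R) : List R → R
  | [] => 1
  | z :: L => gi N (y * z ^ 2) * (L.map fun x => gi N (y * z * x)).prod * pairProd N y L

theorem pairProd_mul_sum_kk_mul_hk_dbl {y : R} (hN : 0 < N) (hy : y ^ N = 0) (hT : 4 * N ≤ T)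
    (L : List R) :
    pairProd N y L * ∑ ρ ∈ box T, kk T y 0 ρ * hk T L (dbl ρ) = 1 := by
  induction L with
  | nil =>
    have : ∀ ρ, hk T ([] : List R) (dbl ρ) = hk T [] ρ := fun ρ => rfl
    simp only [this]
    rw [sum_mul_hk_nil, kk_zero_right, pairProd, one_mul]
  | cons z L ih =>
    rw [← ih, pairProd]
    have h1 : ∀ (G : (ℕ → ℕ) → (ℕ → ℕ) → R),
        ∑ r ∈ box T, kk T y 0 r * ∑ ν ∈ box T, G (dbl r) ν * hk T L ν
          = ∑ ν ∈ box T, (∑ r ∈ box T, kk T y 0 r * G (dbl r) ν) * hk T L ν := by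
      intro G
      simp only [mul_sum, sum_mul, mul_assoc]
      exact sum_comm
    have h2 : ∀ r ∈ box T, kk T y 0 r * hk T L (dbl r) = kk T y 0 r *
        ((L.map fun x => gi N (y * z * x)).prod *
          ∑ ν ∈ box T, uk T (y * z) (dbl r) ν * hk T L ν) := by
      intro r hr
      rcases lt_or_ge (∑ t ∈ range T, r t) N with h | h
      · rw [prod_gi_mul_sum_uk_mul_hk hN (by rw [mul_pow, hy, zero_mul]) L _
          (dbl_mem_box_of_sum_lt hT hr h) (small_dbl_of_sum_lt hT h)]
      · rw [kk_eq_zero hy h, zero_mul, zero_mul]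
    rw [sum_congr rfl h2]
    simp only [hk, mul_left_comm _ (List.prod _)]
    rw [← mul_sum, h1, h1, ← sum_congr rfl fun ν hν =>
      congrArg (· * hk T L ν) (sum_kk_mul_dk_dbl (z := z) hy hT hν)]
    simp only [mul_assoc, ← mul_sum]
    ring

/-- The iterated sums `∑ K_{y₁}(μ, r₁) K_{y₂}(r₁, r₂) ⋯`. -/
noncomputable def kIter (T : ℕ) : List R → (ℕ → ℕ) → R
  | [], _ => 1
  | y :: ys, μ => ∑ r ∈ box T, kk T y μ r * kIter T ys r

/-- The products of initial segments of a list, longest first. -/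
def prefixProds {A : Type*} [CommRing A] : List A → List A
  | [] => [1]
  | y :: ys => (prefixProds ys).map (y * ·) ++ [1]

/-- The product of `gi N` over products of nonempty segments of a list. -/
noncomputable def segProd (N : ℕ) : List R → R
  | [] => 1
  | y :: ys => ((prefixProds ys).map fun x => gi N (y * x)).prod * segProd N ys

theorem segProd_mul_kIter (hT : 2 * N ≤ T) (ys : List R) (hys : ∀ y ∈ ys, y ^ N = 0) :
    ∀ μ ∈ box T, segProd N ys * kIter T ys μ = hk T (prefixProds ys) μ := by
  induction ys with
  | nil => intro μ _; simp [segProd, kIter, prefixProds, hk_singleton_one]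
  | cons y ys ih =>
    intro μ hμ
    rw [prefixProds, ← prod_gi_mul_sum_kk_mul_hk (hys y (by simp)) hT _ μ hμ,
      ← sum_congr rfl fun r hr =>
        congrArg (kk T y μ r * ·) (ih (fun z hz => hys z (by simp [hz])) r hr), segProd, kIter,
      mul_assoc, mul_sum]
    simp only [mul_left_comm (segProd N ys)]

/-- The fermionic sum of type `C` times the inverse of its product side is `1`. -/
theorem segProd_mul_pairProd_mul_sum {y : R} (hN : 0 < N) (hT : 4 * N ≤ T) (hy : y ^ N = 0)
    (ys : List R) (hys : ∀ y ∈ ys, y ^ N = 0) :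
    segProd N ys * pairProd N y (prefixProds ys) *
      ∑ ρ ∈ box T, kk T y 0 ρ * kIter T ys (dbl ρ) = 1 := by
  rw [← pairProd_mul_sum_kk_mul_hk_dbl hN hy hT (prefixProds ys), mul_right_comm, mul_comm, mul_sum]
  congr 1
  refine sum_congr rfl fun ρ hρ => ?_
  rcases lt_or_ge (∑ t ∈ range T, ρ t) N with h | h
  · rw [← segProd_mul_kIter (by omega) ys hys _ (dbl_mem_box_of_sum_lt hT hρ h)]
    ring
  · rw [kk_eq_zero hy h]; ring

end iterated

/-! ### The product over positive roots -/

section roots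

theorem prefixProds_map_range {A : Type*} [CommRing A] (f : ℕ → A) (n : ℕ) : ∀ i,
    prefixProds ((List.range n).map fun k => f (i + k))
      = (List.range (n + 1)).reverse.map fun k => ∏ s ∈ range k, f (i + s) := by
  induction n with
  | zero => intro i; simp [prefixProds]
  | succ n ih =>
    intro i
    have h := ih (i + 1)
    rw [List.range_succ_eq_map, List.map_cons, List.map_map, prefixProds,
      show ((fun k => f (i + k)) ∘ Nat.succ) = fun k => f (i + 1 + k) by
        funext k; simp [add_assoc, add_comm 1], h, List.range_succ_eq_map (n := n + 1)]
    simp only [List.map_map, List.reverse_cons, List.map_append, List.map_reverse,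
      List.map_cons, List.map_nil, prod_range_zero]
    congr 3
    funext k
    simp only [Function.comp, Nat.succ_eq_add_one, prod_range_succ', add_zero, mul_comm (f i)]
    simp only [add_assoc, add_comm 1]

theorem list_prod_map_range {A : Type*} [CommMonoid A] (g : ℕ → A) (m : ℕ) :
    ((List.range m).map g).prod = ∏ i ∈ range m, g i := by
  induction m with
  | zero => simp
  | succ m ih => rw [List.range_succ, List.map_append, List.prod_append, ih, prod_range_succ]; simp

theorem pairProd_map_range (N : ℕ) (y : R) (p : ℕ → R) (m : ℕ) :
    pairProd N y ((List.range m).reverse.map p)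
      = ∏ j ∈ range m, ∏ i ∈ range (j + 1), gi N (y * p i * p j) := by
  induction m with
  | zero => simp [pairProd]
  | succ m ih =>
    rw [List.range_succ, List.reverse_append, List.reverse_singleton, List.singleton_append,
      List.map_cons, pairProd, ih, prod_range_succ, prod_range_succ]
    have h : ((List.map p (List.range m).reverse).map fun x => gi N (y * p m * x)).prod
        = ∏ i ∈ range m, gi N (y * p i * p m) := by
      rw [List.map_reverse, List.map_reverse, List.prod_reverse, List.map_map]
      rw [← list_prod_map_range]
      congr 1
      exact List.map_congr_left fun i _ => by simp only [Function.comp, mul_right_comm]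
    rw [h, show y * p m ^ 2 = y * p m * p m by ring]
    ring

theorem segProd_map_range (N : ℕ) (f : ℕ → R) (n : ℕ) : ∀ i,
    segProd N ((List.range n).map fun k => f (i + k))
      = ∏ a ∈ range n, ∏ k ∈ range (n - a), gi N (∏ s ∈ range (k + 1), f (i + a + s)) := by
  induction n with
  | zero => simp [segProd]
  | succ n ih =>
    intro i
    rw [List.range_succ_eq_map, List.map_cons, List.map_map, segProd,
      show ((fun k => f (i + k)) ∘ Nat.succ) = fun k => f (i + 1 + k) by
        funext k; simp [add_assoc, add_comm 1], ih, prefixProds_map_range, prod_range_succ',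
      List.map_reverse, List.map_reverse, List.prod_reverse, List.map_map, list_prod_map_range,
      mul_comm]
    congr 1
    · refine prod_congr rfl fun a _ => ?_
      rw [Nat.add_sub_add_right]
      simp only [add_assoc, add_comm 1]
    · refine prod_congr rfl fun k _ => ?_
      simp only [Function.comp, prod_range_succ', add_zero, mul_comm (f i)]
      simp only [add_assoc, add_comm 1]

/-- The root `α_a + ⋯ + α_{b}` with `a = p.1 + 2` and `b = a + p.2`. -/
def segRoot (p : (_ : ℕ) × ℕ) : ℕ → ℕ := fun s => if p.1 + 2 ≤ s ∧ s ≤ p.1 + 2 + p.2 then 1 else 0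

/-- The root `α_1 + (α_2 + ⋯ + α_a) + (α_2 + ⋯ + α_b)` with `a = p.2 + 1` and `b = p.1 + 1`. -/
def pairRoot (p : (_ : ℕ) × ℕ) : ℕ → ℕ := fun s => (if s = 1 then 1 else 0) +
  (if 2 ≤ s ∧ s ≤ p.2 + 1 then 1 else 0) + (if 2 ≤ s ∧ s ≤ p.1 + 1 then 1 else 0)

theorem segRoot_injective : Function.Injective segRoot := by
  rintro ⟨a, k⟩ ⟨a', k'⟩ h
  have h1 := congrFun h (a + 2)
  have h2 := congrFun h (a + 2 + k)
  have h3 := congrFun h (a' + 2)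
  have h4 := congrFun h (a' + 2 + k')
  simp only [segRoot] at h1 h2 h3 h4
  obtain ⟨rfl, rfl⟩ : a = a' ∧ k = k' := by
    split_ifs at h1 h2 h3 h4 <;> omega
  rfl

theorem pairRoot_eq_zero_iff {i j s : ℕ} (h : i ≤ j) (hs : 2 ≤ s) :
    pairRoot ⟨j, i⟩ s = 0 ↔ j + 1 < s := by
  simp only [pairRoot]
  split_ifs <;> simp <;> omega

theorem pairRoot_eq_two_iff {i j s : ℕ} (h : i ≤ j) (hs : 2 ≤ s) :
    pairRoot ⟨j, i⟩ s = 2 ↔ s ≤ i + 1 := by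
  simp only [pairRoot]
  split_ifs <;> omega

theorem pairRoot_injOn (n : ℕ) :
    Set.InjOn pairRoot ((range n).sigma fun j => range (j + 1) : Finset ((_ : ℕ) × ℕ)) := by
  rintro ⟨j, i⟩ hj ⟨j', i'⟩ hj' h
  simp only [coe_sigma, Set.mem_sigma_iff, mem_coe, mem_range] at hj hj'
  have hi : i ≤ j := by omega
  have hi' : i' ≤ j' := by omega
  have h0 : ∀ s, 2 ≤ s → (j + 1 < s ↔ j' + 1 < s) := fun s hs => by
    rw [← pairRoot_eq_zero_iff hi hs, ← pairRoot_eq_zero_iff hi' hs, h]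
  have h2 : ∀ s, 2 ≤ s → (s ≤ i + 1 ↔ s ≤ i' + 1) := fun s hs => by
    rw [← pairRoot_eq_two_iff hi hs, ← pairRoot_eq_two_iff hi' hs, h]
  have e1 := h0 (j + 2) (by omega)
  have e2 := h0 (j' + 2) (by omega)
  have e3 := h2 (i + 2) (by omega)
  have e4 := h2 (i' + 2) (by omega)
  obtain ⟨rfl, rfl⟩ : j = j' ∧ i = i' := by omega
  rfl

theorem prod_pow_ite_Icc {A : Type*} [CommMonoid A] (f : ℕ → A) {a b l : ℕ} (ha : 1 ≤ a)
    (hb : b ≤ l + 1) :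
    ∏ s ∈ Icc 1 l, f s ^ (if a ≤ s ∧ s + 1 ≤ b then 1 else 0) = ∏ s ∈ range (b - a), f (a + s) := by
  rw [← prod_Ico_eq_prod_range]
  symm
  refine prod_subset_one_on_sdiff (fun s hs => ?_) (fun s hs => ?_) (fun s hs => ?_)
  · rw [mem_Ico] at hs; rw [mem_Icc]; omega
  · rw [mem_sdiff, mem_Ico] at hs
    rw [if_neg (by omega), pow_zero]
  · rw [mem_Ico] at hs
    rw [if_pos (by omega), pow_one]

theorem prod_pow_segRoot {A : Type*} [CommMonoid A] (f : ℕ → A) {l a k : ℕ} (h : a + 2 + k ≤ l) :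
    ∏ s ∈ Icc 1 l, f s ^ segRoot ⟨a, k⟩ s = ∏ s ∈ range (k + 1), f (2 + a + s) := by
  have := prod_pow_ite_Icc f (a := a + 2) (b := a + 2 + k + 1) (l := l) (by omega) (by omega)
  simp only [Nat.add_le_add_iff_right] at this
  rw [show k + 1 = a + 2 + k + 1 - (a + 2) by omega, add_comm 2 a, ← this]
  rfl

theorem prod_pow_pairRoot {A : Type*} [CommMonoid A] (f : ℕ → A) {l i j : ℕ} (hi : i + 1 ≤ l)
    (hj : j + 1 ≤ l) :
    ∏ s ∈ Icc 1 l, f s ^ pairRoot ⟨j, i⟩ s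
      = f 1 * (∏ s ∈ range i, f (2 + s)) * ∏ s ∈ range j, f (2 + s) := by
  have h1 := prod_pow_ite_Icc f (a := 1) (b := 2) (l := l) (by omega) (by omega)
  have h2 := prod_pow_ite_Icc f (a := 2) (b := i + 2) (l := l) (by omega) (by omega)
  have h3 := prod_pow_ite_Icc f (a := 2) (b := j + 2) (l := l) (by omega) (by omega)
  simp only [Nat.add_sub_cancel, show 2 - 1 = 1 from rfl, range_one, prod_singleton,
    add_zero] at h1 h2 h3
  rw [← h2, ← h3]
  conv_rhs => rw [← h1]
  rw [← prod_mul_distrib, ← prod_mul_distrib]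
  refine prod_congr rfl fun s hs => ?_
  rw [← pow_add, ← pow_add, pairRoot]
  have e1 : (1 ≤ s ∧ s + 1 ≤ 2) ↔ s = 1 := by omega
  have e2 : ∀ i, (2 ≤ s ∧ s + 1 ≤ i + 2) ↔ (2 ≤ s ∧ s ≤ i + 1) := by omega
  simp only [e1, e2]

theorem prod_roots {A : Type*} [CommMonoid A] (g : (ℕ → ℕ) → A) {l n : ℕ} (hl : l = n + 1)
    (Φ : Finset (ℕ → ℕ))
    (hΦ : ∀ c : ℕ → ℕ, c ∈ Φ ↔
      ((c = fun s => if s = 1 then 1 else 0)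
        ∨ (∃ m, 2 ≤ m ∧ m ≤ l ∧
          c = fun s => (if s = 1 then 1 else 0) + (if 2 ≤ s ∧ s ≤ m then 2 else 0))
        ∨ (∃ i j, 2 ≤ i ∧ i ≤ j ∧ j ≤ l ∧
          c = fun s => if i ≤ s ∧ s ≤ j then 1 else 0)
        ∨ (∃ b, 2 ≤ b ∧ b ≤ l ∧
          c = fun s => if 1 ≤ s ∧ s ≤ b then 1 else 0)
        ∨ (∃ a b, 2 ≤ a ∧ a < b ∧ b ≤ l ∧
          c = fun s => (if s = 1 then 1 else 0) + (if 2 ≤ s ∧ s ≤ a then 2 else 0)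
            + (if a + 1 ≤ s ∧ s ≤ b then 1 else 0)))) :
    ∏ c ∈ Φ, g c = (∏ a ∈ range n, ∏ k ∈ range (n - a), g (segRoot ⟨a, k⟩)) *
      ∏ j ∈ range (n + 1), ∏ i ∈ range (j + 1), g (pairRoot ⟨j, i⟩) := by
  classical
  have hΦ' : Φ = ((range n).sigma fun a => range (n - a)).image segRoot ∪
      ((range (n + 1)).sigma fun j => range (j + 1)).image pairRoot := by
    ext c
    rw [hΦ, mem_union, mem_image, mem_image]
    constructor
    · rintro (rfl | ⟨m, h1, h2, rfl⟩ | ⟨i, j, h1, h2, h3, rfl⟩ | ⟨b, h1, h2, rfl⟩ |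
        ⟨a, b, h1, h2, h3, rfl⟩)
      · refine Or.inr ⟨⟨0, 0⟩, by simp, ?_⟩
        funext s
        simp only [pairRoot]
        split_ifs <;> omega
      · refine Or.inr ⟨⟨m - 1, m - 1⟩, by simp; omega, ?_⟩
        funext s
        simp only [pairRoot]
        split_ifs <;> omega
      · refine Or.inl ⟨⟨i - 2, j - i⟩, by simp; omega, ?_⟩
        funext s
        simp only [segRoot]
        split_ifs <;> omega
      · refine Or.inr ⟨⟨b - 1, 0⟩, by simp; omega, ?_⟩
        funext s
        simp only [pairRoot]
        split_ifs <;> omega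
      · refine Or.inr ⟨⟨b - 1, a - 1⟩, by simp; omega, ?_⟩
        funext s
        simp only [pairRoot]
        split_ifs <;> omega
    · rintro (⟨⟨a, k⟩, h, rfl⟩ | ⟨⟨j, i⟩, h, rfl⟩)
      · simp only [mem_sigma, mem_range] at h
        exact Or.inr (Or.inr (Or.inl ⟨a + 2, a + 2 + k, by omega, by omega, by omega, rfl⟩))
      · simp only [mem_sigma, mem_range] at h
        rcases Nat.eq_zero_or_pos j with rfl | hj
        · obtain rfl : i = 0 := by omega
          refine Or.inl ?_
          funext s
          simp only [pairRoot]
          split_ifs <;> omega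
        · rcases Nat.eq_zero_or_pos i with rfl | hi
          · refine Or.inr (Or.inr (Or.inr (Or.inl ⟨j + 1, by omega, by omega, ?_⟩)))
            funext s
            simp only [pairRoot]
            split_ifs <;> omega
          · rcases (show i ≤ j by omega).eq_or_lt with rfl | hij
            · refine Or.inr (Or.inl ⟨i + 1, by omega, by omega, ?_⟩)
              funext s
              simp only [pairRoot]
              split_ifs <;> omega
            · refine Or.inr (Or.inr (Or.inr (Or.inr
                ⟨i + 1, j + 1, by omega, by omega, by omega, ?_⟩)))
              funext s
              simp only [pairRoot]
              split_ifs <;> omega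
  rw [hΦ', prod_union, prod_image segRoot_injective.injOn, prod_image (pairRoot_injOn _),
    prod_sigma, prod_sigma]
  rw [disjoint_left]
  rintro c h1 h2
  obtain ⟨p, -, rfl⟩ := mem_image.1 h1
  obtain ⟨p', -, h⟩ := mem_image.1 h2
  have := congrFun h 1
  simp [segRoot, pairRoot] at this

/-- The product side of type `C` as a product over the positive roots. -/
theorem segProd_mul_pairProd_eq_prod_roots (N : ℕ) (f : ℕ → R) (n : ℕ) :
    segProd N ((List.range n).map fun k => f (2 + k)) *
        pairProd N (f 1) (prefixProds ((List.range n).map fun k => f (2 + k)))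
      = (∏ a ∈ range n, ∏ k ∈ range (n - a),
          gi N (∏ s ∈ Icc 1 (n + 1), f s ^ segRoot ⟨a, k⟩ s)) *
        ∏ j ∈ range (n + 1), ∏ i ∈ range (j + 1),
          gi N (∏ s ∈ Icc 1 (n + 1), f s ^ pairRoot ⟨j, i⟩ s) := by
  rw [prefixProds_map_range, pairProd_map_range, segProd_map_range]
  congr 1
  · refine prod_congr rfl fun a ha => prod_congr rfl fun k hk => ?_
    rw [mem_range] at ha hk
    rw [prod_pow_segRoot f (by omega)]
  · refine prod_congr rfl fun j hj => prod_congr rfl fun i hi => ?_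
    rw [mem_range] at hi hj
    rw [prod_pow_pairRoot f (by omega) (by omega)]

end roots

/-! ### Sums over tuples of descending sequences -/

section tuples

variable {T : ℕ}

open Classical in
/-- Families `r` with `r j ∈ box T` for `i ≤ j < i + n` and `r j = 0` otherwise. -/
noncomputable def tuples (T : ℕ) : ℕ → ℕ → Finset (ℕ → ℕ → ℕ)
  | _, 0 => {0}
  | i, n + 1 => (box T ×ˢ tuples T (i + 1) n).image fun p => Function.update p.2 i p.1

theorem mem_tuples {n : ℕ} : ∀ {i : ℕ} {r : ℕ → ℕ → ℕ},
    r ∈ tuples T i n ↔ (∀ j, i ≤ j → j < i + n → r j ∈ box T) ∧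
      ∀ j, ¬(i ≤ j ∧ j < i + n) → r j = 0 := by
  classical
  induction n with
  | zero =>
    intro i r
    rw [tuples, mem_singleton]
    constructor
    · rintro rfl
      exact ⟨fun j h1 h2 => by omega, fun _ _ => rfl⟩
    · rintro ⟨-, h⟩
      exact funext fun j => h j (by omega)
  | succ n ih =>
    intro i r
    rw [tuples, mem_image]
    constructor
    · rintro ⟨⟨p, s⟩, h, rfl⟩
      rw [mem_product, ih] at h
      obtain ⟨hp, h1, h2⟩ := h
      refine ⟨fun j hj hj' => ?_, fun j hj => ?_⟩
      · rcases eq_or_ne j i with rfl | hne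
        · simpa using hp
        · rw [Function.update_of_ne hne]
          exact h1 j (by omega) (by omega)
      · rw [Function.update_of_ne (by omega)]
        exact h2 j (by omega)
    · rintro ⟨h1, h2⟩
      refine ⟨(r i, Function.update r i 0), ?_, by simp⟩
      rw [mem_product, ih]
      refine ⟨h1 i le_rfl (by omega), fun j hj hj' => ?_, fun j hj => ?_⟩
      · dsimp only
        rw [Function.update_of_ne (by omega)]
        exact h1 j (by omega) (by omega)
      · rcases eq_or_ne j i with rfl | hne
        · simp
        · dsimp only
          rw [Function.update_of_ne hne]
          exact h2 j (by omega)

theorem sum_tuples_succ {A : Type*} [AddCommMonoid A] (F : (ℕ → ℕ → ℕ) → A) (i n : ℕ) :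
    ∑ r ∈ tuples T i (n + 1), F r
      = ∑ p ∈ box T, ∑ s ∈ tuples T (i + 1) n, F (Function.update s i p) := by
  classical
  rw [tuples, sum_image, sum_product]
  rintro ⟨p, s⟩ h ⟨p', s'⟩ h' heq
  simp only [coe_product, Set.mem_prod, mem_coe] at h h'
  have hp : p = p' := by simpa using congrFun heq i
  have hs : s = s' := by
    funext j
    rcases eq_or_ne j i with rfl | hne
    · rw [(mem_tuples.1 h.2).2 j (by omega), (mem_tuples.1 h'.2).2 j (by omega)]
    · simpa [Function.update_of_ne hne] using congrFun heq j
  rw [hp, hs]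

theorem kIter_map_range (f : ℕ → R) (n : ℕ) : ∀ (i : ℕ) (μ : ℕ → ℕ),
    kIter T ((List.range n).map fun k => f (i + 1 + k)) μ
      = ∑ r ∈ tuples T (i + 1) n, ∏ k ∈ range n,
          kk T (f (i + 1 + k)) (Function.update r i μ (i + k)) (r (i + 1 + k)) := by
  induction n with
  | zero => intro i μ; simp [kIter, tuples]
  | succ n ih =>
    intro i μ
    rw [List.range_succ_eq_map, List.map_cons, List.map_map, kIter, sum_tuples_succ]
    refine sum_congr rfl fun p _ => ?_
    rw [show ((fun k => f (i + 1 + k)) ∘ Nat.succ) = fun k => f (i + 1 + 1 + k) by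
      funext k; exact congrArg f (by rw [Nat.succ_eq_add_one]; omega), ih, mul_sum]
    refine sum_congr rfl fun s _ => ?_
    rw [prod_range_succ', mul_comm]
    congr 1
    · refine prod_congr rfl fun k _ => ?_
      rw [show i + 1 + 1 + k = i + 1 + (k + 1) by omega, show i + 1 + k = i + (k + 1) by omega,
        Function.update_of_ne (show i + (k + 1) ≠ i by omega),
        Function.update_of_ne (show i + 1 + (k + 1) ≠ i + 1 by omega)]
    · simp

/-- The sequence paired with `r (2 + k)` in the energy. -/
def prev (r : ℕ → ℕ → ℕ) (k : ℕ) : ℕ → ℕ := if k = 0 then dbl (r 1) else r (1 + k)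

theorem sum_kk_mul_kIter_dbl (f : ℕ → R) (n : ℕ) :
    ∑ ρ ∈ box T, kk T (f 1) 0 ρ * kIter T ((List.range n).map fun k => f (2 + k)) (dbl ρ)
      = ∑ r ∈ tuples T 1 (n + 1), kk T (f 1) 0 (r 1) *
          ∏ k ∈ range n, kk T (f (2 + k)) (prev r k) (r (2 + k)) := by
  rw [sum_tuples_succ]
  refine sum_congr rfl fun ρ _ => ?_
  rw [kIter_map_range f n 1, mul_sum]
  refine sum_congr rfl fun r _ => ?_
  rw [Function.update_self]
  congr 1
  refine prod_congr rfl fun k _ => ?_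
  rw [Function.update_of_ne (show 2 + k ≠ 1 by omega), prev]
  split_ifs with hk
  · simp [hk]
  · rw [Function.update_of_ne (show 1 + k ≠ 1 by omega),
      Function.update_of_ne (show 1 + k ≠ 1 by omega)]

theorem qz_sum {ι : Type*} (s : Finset ι) (g : ι → ℤ) :
    (qz (∑ t ∈ s, g t) : R) = ∏ t ∈ s, qz (g t) := by
  classical
  induction s using Finset.induction_on with
  | empty => simp
  | insert a s ha ih => rw [sum_insert ha, prod_insert ha, qz_add, ih]

theorem kk_eq_prod (y : R) (μ : ℕ → ℕ) {r : ℕ → ℕ} (hr : r ∈ box T) :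
    kk T y μ r = y ^ (∑ t ∈ range T, r t) *
      qz (∑ t ∈ range T, ((r t : ℤ) ^ 2 - r t * μ t)) * ∏ t ∈ range T, iq (r t - r (t + 1)) := by
  rw [kk, prod_mul_distrib, prod_mul_distrib, prod_pow_eq_pow_sum, qz_sum]
  congr 1
  exact prod_congr rfl fun t _ => iz_of_le (succ_le_of_mem_box hr t)

end tuples

/-! ### The energy function -/

section energy

/-- The energy of a family of sequences supported on `t < T`. -/
def energy (T n : ℕ) (r : ℕ → ℕ → ℕ) : ℤ :=
  ∑ t ∈ range T, (r 1 t : ℤ) ^ 2 +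
    ∑ k ∈ range n, ∑ t ∈ range T, ((r (2 + k) t : ℤ) ^ 2 - r (2 + k) t * prev r k t)

theorem finsum_eq_sum_range {A : Type*} [AddCommMonoid A] {T : ℕ} {g : ℕ → A}
    (h : ∀ t, T ≤ t → g t = 0) : ∑ᶠ t, g t = ∑ t ∈ range T, g t := by
  refine finsum_eq_sum_of_support_subset g fun t ht => ?_
  rw [coe_range, Set.mem_Iio]
  by_contra hc
  exact ht (h t (by omega))

theorem sum_mul_dbl {T : ℕ} (a b : ℕ → ℕ) (hb : ∀ t, T ≤ t → b t = 0) :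
    ∑ t ∈ range T, (b t : ℤ) * dbl a t
      = ∑ t ∈ range T, (a t : ℤ) * ((b (2 * t) : ℤ) + (b (2 * t + 1) : ℤ)) := by
  have h : ∑ t ∈ range T, (b t : ℤ) * dbl a t = ∑ t ∈ range (2 * T), (b t : ℤ) * dbl a t := by
    refine sum_subset (range_mono (by omega)) fun t _ ht => ?_
    rw [hb t (by simpa using ht)]
    simp
  rw [h]
  clear h hb
  induction T with
  | zero => simp
  | succ T ih =>
    rw [mul_add_one, sum_range_succ, sum_range_succ, ih, sum_range_succ]
    have e1 : dbl a (2 * T) = a T := congrArg a (by omega)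
    have e2 : dbl a (2 * T + 1) = a T := congrArg a (by omega)
    rw [e1, e2]
    ring

theorem energy_eq {T n l : ℕ} (hn : 1 ≤ n) (hl : l = n + 1) (r : ℕ → ℕ → ℕ)
    (hr : ∀ i t, T ≤ t → r i t = 0) :
    (∑ i ∈ Icc 1 l, ∑ᶠ t : ℕ, (r i t : ℤ) ^ 2)
        - (∑ᶠ t : ℕ, (r 1 t : ℤ) * ((r 2 (2 * t) : ℤ) + (r 2 (2 * t + 1) : ℤ)))
        - ∑ i ∈ Icc 3 l, ∑ᶠ t : ℕ, (r (i - 1) t : ℤ) * (r i t : ℤ) = energy T n r := by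
  subst hl
  obtain ⟨m, rfl⟩ : ∃ m, n = m + 1 := ⟨n - 1, by omega⟩
  have h1 : ∀ i, ∑ᶠ t : ℕ, (r i t : ℤ) ^ 2 = ∑ t ∈ range T, (r i t : ℤ) ^ 2 := fun i =>
    finsum_eq_sum_range fun t ht => by simp [hr i t ht]
  have h2 : ∑ᶠ t : ℕ, (r 1 t : ℤ) * ((r 2 (2 * t) : ℤ) + (r 2 (2 * t + 1) : ℤ))
      = ∑ t ∈ range T, (r 2 t : ℤ) * dbl (r 1) t := by
    rw [sum_mul_dbl _ _ (hr 2)]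
    exact finsum_eq_sum_range fun t ht => by simp [hr 1 t ht]
  have h3 : ∀ i, ∑ᶠ t : ℕ, (r (i - 1) t : ℤ) * (r i t : ℤ)
      = ∑ t ∈ range T, (r (i - 1) t : ℤ) * (r i t : ℤ) := fun i =>
    finsum_eq_sum_range fun t ht => by simp [hr i t ht]
  simp only [h1, h2, h3, energy, sum_sub_distrib]
  have e1 : Icc 1 (m + 1 + 1) = Ico 1 (m + 3) := rfl
  have e2 : Icc 3 (m + 1 + 1) = Ico 3 (m + 3) := rfl
  rw [e1, e2, sum_Ico_eq_sum_range, sum_Ico_eq_sum_range, show m + 3 - 1 = m + 1 + 1 by omega,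
    show m + 3 - 3 = m by omega, sum_range_succ', sum_range_succ' (fun k => ∑ t ∈ range T,
      (r (2 + k) t : ℤ) * (prev r k t : ℤ))]
  have e3 : prev r 0 = dbl (r 1) := if_pos rfl
  have e4 : ∀ k, prev r (k + 1) = r (2 + k) := fun k => by
    rw [prev, if_neg (by omega)]; congr 1; omega
  have e5 : ∀ k, 1 + (k + 1) = 2 + k := by omega
  have e6 : ∀ k, 2 + (k + 1) = 3 + k := by omega
  have e7 : ∀ k, 3 + k - 1 = 2 + k := by omega
  simp only [e3, e4, e5, e6, e7, add_zero, mul_comm (r (3 + _) _ : ℤ)]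
  ring

theorem two_mul_sum_mul_le (T : ℕ) (a b : ℕ → ℕ) :
    2 * ∑ t ∈ range T, (a t : ℤ) * b t
      ≤ ∑ t ∈ range T, (a t : ℤ) ^ 2 + ∑ t ∈ range T, (b t : ℤ) ^ 2 := by
  rw [mul_sum, ← sum_add_distrib]
  exact sum_le_sum fun t _ => by nlinarith [sq_nonneg ((a t : ℤ) - b t)]

theorem le_two_mul_energy (T m : ℕ) (r : ℕ → ℕ → ℕ) :
    ∑ t ∈ range T, (r (2 + m) t : ℤ) ^ 2 ≤ 2 * energy T (m + 1) r := by
  induction m with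
  | zero =>
    have h1 := two_mul_sum_mul_le T (r 2) (dbl (r 1))
    have h2 : ∑ t ∈ range T, (dbl (r 1) t : ℤ) ^ 2 ≤ 2 * ∑ t ∈ range T, (r 1 t : ℤ) ^ 2 := by
      exact_mod_cast sum_dbl_le (fun t => r 1 t ^ 2) T
    have e : prev r 0 = dbl (r 1) := if_pos rfl
    simp only [energy, zero_add, sum_range_one, add_zero, e, sum_sub_distrib]
    linarith
  | succ m ih =>
    have h1 := two_mul_sum_mul_le T (r (2 + (m + 1))) (r (2 + m))
    have e : prev r (m + 1) = r (2 + m) := by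
      rw [prev, if_neg (by omega)]; congr 1; omega
    have h2 : energy T (m + 1 + 1) r = energy T (m + 1) r + (∑ t ∈ range T,
        (r (2 + (m + 1)) t : ℤ) ^ 2 - ∑ t ∈ range T, (r (2 + (m + 1)) t : ℤ) * r (2 + m) t) := by
      rw [energy, energy, sum_range_succ _ (m + 1), e, sum_sub_distrib]
      ring
    rw [h2]
    linarith

theorem energy_nonneg (T : ℕ) {n : ℕ} (hn : 1 ≤ n) (r : ℕ → ℕ → ℕ) : 0 ≤ energy T n r := by
  obtain ⟨m, rfl⟩ : ∃ m, n = m + 1 := ⟨n - 1, by omega⟩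
  have := le_two_mul_energy T m r
  have : (0 : ℤ) ≤ ∑ t ∈ range T, (r (2 + m) t : ℤ) ^ 2 := by positivity
  linarith

/-- A product of kernels, rewritten with the energy. -/
theorem kk_mul_prod_kk {T n : ℕ} (hn : 1 ≤ n) (f : ℕ → R) {r : ℕ → ℕ → ℕ}
    (hr : r ∈ tuples T 1 (n + 1)) :
    kk T (f 1) 0 (r 1) * ∏ k ∈ range n, kk T (f (2 + k)) (prev r k) (r (2 + k))
      = (QBase.q : Rˣ) ^ (energy T n r).toNat *
        (∏ i ∈ Icc 1 (n + 1), f i ^ ∑ t ∈ range T, r i t) *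
        ∏ i ∈ Icc 1 (n + 1), ∏ t ∈ range T, iq (r i t - r i (t + 1)) := by
  have hb := (mem_tuples.1 hr).1
  rw [← qz_natCast, Int.toNat_of_nonneg (energy_nonneg T hn r), energy, qz_add, qz_sum (range n),
    kk_eq_prod _ _ (hb 1 le_rfl (by omega)), prod_congr rfl fun k hk =>
      kk_eq_prod (f (2 + k)) (prev r k) (hb (2 + k) (by omega) (by rw [mem_range] at hk; omega))]
  have e : ∀ g : ℕ → R, ∏ i ∈ Icc 1 (n + 1), g i = g 1 * ∏ k ∈ range n, g (2 + k) := by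
    intro g
    rw [show Icc 1 (n + 1) = Ico 1 (n + 2) from rfl, prod_Ico_eq_prod_range,
      show n + 2 - 1 = n + 1 by omega, prod_range_succ', mul_comm]
    congr 1
    exact prod_congr rfl fun k _ => congrArg g (by omega)
  simp only [e, prod_mul_distrib, Pi.zero_apply, Nat.cast_zero, mul_zero, sub_zero]
  ring

end energy

/-- The type `C` identity over a ring in which the variables are nilpotent. -/
theorem prod_gi_mul_sum_tuples {N T n l : ℕ} (hN : 0 < N) (hT : 4 * N ≤ T) (hn : 1 ≤ n)
    (hl : l = n + 1) (f : ℕ → R) (hf : ∀ i ∈ Icc 1 l, f i ^ N = 0) (Φ : Finset (ℕ → ℕ))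
    (hΦ : ∀ c : ℕ → ℕ, c ∈ Φ ↔
      ((c = fun s => if s = 1 then 1 else 0)
        ∨ (∃ m, 2 ≤ m ∧ m ≤ l ∧
          c = fun s => (if s = 1 then 1 else 0) + (if 2 ≤ s ∧ s ≤ m then 2 else 0))
        ∨ (∃ i j, 2 ≤ i ∧ i ≤ j ∧ j ≤ l ∧
          c = fun s => if i ≤ s ∧ s ≤ j then 1 else 0)
        ∨ (∃ b, 2 ≤ b ∧ b ≤ l ∧
          c = fun s => if 1 ≤ s ∧ s ≤ b then 1 else 0)
        ∨ (∃ a b, 2 ≤ a ∧ a < b ∧ b ≤ l ∧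
          c = fun s => (if s = 1 then 1 else 0) + (if 2 ≤ s ∧ s ≤ a then 2 else 0)
            + (if a + 1 ≤ s ∧ s ≤ b then 1 else 0)))) :
    (∏ c ∈ Φ, gi N (∏ s ∈ Icc 1 l, f s ^ c s)) * ∑ r ∈ tuples T 1 l,
      (QBase.q : Rˣ) ^ (energy T n r).toNat * (∏ i ∈ Icc 1 l, f i ^ ∑ t ∈ range T, r i t) *
        ∏ i ∈ Icc 1 l, ∏ t ∈ range T, iq (r i t - r i (t + 1)) = 1 := by
  rw [prod_roots _ hl Φ hΦ]
  subst hl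
  rw [← sum_congr rfl fun r hr => kk_mul_prod_kk hn f hr, ← sum_kk_mul_kIter_dbl,
    ← segProd_mul_pairProd_eq_prod_roots]
  refine segProd_mul_pairProd_mul_sum hN hT (hf 1 (by simp)) _ fun y hy => ?_
  obtain ⟨k, hk, rfl⟩ := List.mem_map.1 hy
  rw [List.mem_range] at hk
  exact hf _ (by rw [mem_Icc]; omega)

/-! ### Truncation of power series -/

section truncation

/-- The power series whose coefficients vanish on a lower set of exponents. -/
def vanishingIdeal {σ : Type*} (S : LowerSet (σ →₀ ℕ)) : Ideal (MvPowerSeries σ ℤ) where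
  carrier := {b | ∀ d ∈ S, coeff d b = 0}
  zero_mem' := fun d _ => by simp
  add_mem' := fun ha hb d hd => by rw [map_add, ha d hd, hb d hd, add_zero]
  smul_mem' := fun c b hb d hd => by
    classical
    rw [smul_eq_mul, coeff_mul]
    refine sum_eq_zero fun p hp => ?_
    rw [hb p.2 (S.lower (HasAntidiagonal.mem_antidiagonal.1 hp ▸ le_add_self) hd), mul_zero]

/-- The exponents of degree less than `N` in every variable other than `q`. -/
def yCut (l N : ℕ) : LowerSet (Fin (l + 1) →₀ ℕ) where
  carrier := {d | ∀ i, i ≠ 0 → d i < N}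
  lower' := fun _ _ hle h i hi => (hle i).trans_lt (h i hi)

theorem exists_mem_yCut {l : ℕ} (d : Fin (l + 1) →₀ ℕ) : ∃ N, 0 < N ∧ d ∈ yCut l N :=
  ⟨univ.sup d + 1, Nat.succ_pos _, fun i _ => Nat.lt_succ_of_le (le_sup (mem_univ i))⟩

theorem Q_pow_dvd_iff {l n : ℕ} {b : MvPowerSeries (Fin (l + 1)) ℤ} :
    Q l ^ n ∣ b ↔ ∀ d, d 0 < n → coeff d b = 0 := X_pow_dvd_iff

theorem Y_pow_mem {l N i : ℕ} (hi : i ∈ Icc 1 l) : Y l i ^ N ∈ vanishingIdeal (yCut l N) := by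
  rw [mem_Icc] at hi
  have hlt : i < l + 1 := by omega
  intro d hd
  rw [Y, dif_pos hlt]
  refine X_pow_dvd_iff.1 (dvd_refl _) d (hd _ ?_)
  rw [Ne, Fin.ext_iff]
  exact (by omega : ¬ i = 0)

theorem mem_of_Q_pow_mul_mem {l N k : ℕ} {b : MvPowerSeries (Fin (l + 1)) ℤ}
    (h : Q l ^ k * b ∈ vanishingIdeal (yCut l N)) : b ∈ vanishingIdeal (yCut l N) := by
  intro d hd
  have := h (Finsupp.single 0 k + d) fun i hi => by
    rw [Finsupp.add_apply, Finsupp.single_eq_of_ne hi, zero_add]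
    exact hd i hi
  rwa [Q, X_pow_eq, coeff_add_monomial_mul, one_mul] at this

/-- Power series truncated in the variables other than `q`, with `q` inverted. -/
abbrev LaurentTrunc (l N : ℕ) : Type :=
  Localization.Away (Ideal.Quotient.mk (vanishingIdeal (yCut l N)) (Q l))

/-- The map to truncated Laurent series. -/
noncomputable def toTrunc (l N : ℕ) : MvPowerSeries (Fin (l + 1)) ℤ →+* LaurentTrunc l N :=
  (algebraMap (_ ⧸ vanishingIdeal (yCut l N)) (LaurentTrunc l N)).comp (Ideal.Quotient.mk _)

theorem toTrunc_eq_zero_iff {l N : ℕ} {b : MvPowerSeries (Fin (l + 1)) ℤ} :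
    toTrunc l N b = 0 ↔ b ∈ vanishingIdeal (yCut l N) := by
  rw [toTrunc, RingHom.comp_apply]
  constructor
  · intro h
    obtain ⟨⟨_, k, rfl⟩, hk⟩ := (IsLocalization.map_eq_zero_iff
      (Submonoid.powers (Ideal.Quotient.mk (vanishingIdeal (yCut l N)) (Q l))) _ _).1 h
    dsimp only at hk
    rw [← map_pow, ← map_mul, Ideal.Quotient.eq_zero_iff_mem] at hk
    exact mem_of_Q_pow_mul_mem hk
  · intro h
    rw [Ideal.Quotient.eq_zero_iff_mem.2 h, map_zero]

theorem isUnit_one_sub_Q_pow_mul (l n : ℕ) (u : MvPowerSeries (Fin (l + 1)) ℤ) :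
    IsUnit (1 - Q l ^ (n + 1) * u) := by
  rw [isUnit_iff_constantCoeff]
  simp [Q]

theorem isUnit_one_sub_Q_pow (l n : ℕ) : IsUnit (1 - Q l ^ (n + 1)) := by
  simpa using isUnit_one_sub_Q_pow_mul l n 1

noncomputable instance (l N : ℕ) : QBase (LaurentTrunc l N) where
  q := (IsLocalization.Away.algebraMap_isUnit (S := LaurentTrunc l N)
    (Ideal.Quotient.mk (vanishingIdeal (yCut l N)) (Q l))).unit
  isUnit_one_sub := fun n => by
    have := (isUnit_one_sub_Q_pow l n).map (toTrunc l N)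
    rwa [map_sub, map_one, map_pow] at this

theorem toTrunc_Q (l N : ℕ) :
    toTrunc l N (Q l) = ((QBase.q : (LaurentTrunc l N)ˣ) : LaurentTrunc l N) := rfl

theorem toTrunc_Q_pow (l N n : ℕ) : toTrunc l N (Q l ^ n) = qz (n : ℤ) := by
  rw [map_pow, toTrunc_Q, qz_natCast]

theorem isUnit_qPoch (l m : ℕ) : IsUnit (qPoch l m) := by
  rw [qPoch]
  exact IsUnit.prod_iff.2 fun u _ => isUnit_one_sub_Q_pow l u

theorem toTrunc_qPoch (l N m : ℕ) : toTrunc l N (qPoch l m) = qf m := by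
  rw [qPoch, qf, map_prod]
  refine prod_congr rfl fun u _ => ?_
  rw [map_sub, map_one, toTrunc_Q_pow, Nat.cast_succ]

theorem toTrunc_inverse_qPoch (l N m : ℕ) : toTrunc l N (Ring.inverse (qPoch l m)) = iq m := by
  have h1 := congrArg (toTrunc l N) (Ring.mul_inverse_cancel _ (isUnit_qPoch l m))
  rw [map_mul, toTrunc_qPoch, map_one] at h1
  exact (isUnit_qf m).mul_left_cancel (h1.trans (qf_mul_iq m).symm)

end truncation

/-! ### Infinite sums and products of power series -/

section convergence

variable {l : ℕ}

instance (σ A : Type*) [TopologicalSpace A] [T2Space A] : T2Space (MvPowerSeries σ A) :=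
  inferInstanceAs (T2Space ((σ →₀ ℕ) → A))

theorem coeff_eq_of_Q_pow_dvd_sub {n : ℕ} {a b : MvPowerSeries (Fin (l + 1)) ℤ}
    (h : Q l ^ n ∣ a - b) {d : Fin (l + 1) →₀ ℕ} (hd : d 0 < n) : coeff d a = coeff d b := by
  have := Q_pow_dvd_iff.1 h d hd
  rwa [map_sub, sub_eq_zero] at this

theorem dvd_prod_sub_one {A ι : Type*} [CommRing A] (p : A) (s : Finset ι) (g : ι → A)
    (h : ∀ n ∈ s, p ∣ g n - 1) : p ∣ ∏ n ∈ s, g n - 1 := by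
  refine prod_induction g (fun x => p ∣ x - 1) (fun a b ha hb => ?_) (by simp) h
  rw [show a * b - 1 = (a - 1) * b + (b - 1) by ring]
  exact dvd_add (ha.mul_right b) hb

theorem Q_pow_dvd_prod_sub (g : ℕ → MvPowerSeries (Fin (l + 1)) ℤ)
    (hg : ∀ n, Q l ^ (n + 1) ∣ g n - 1) {m : ℕ} {s : Finset ℕ} (hs : range m ⊆ s) :
    Q l ^ m ∣ ∏ n ∈ s, g n - ∏ n ∈ range m, g n := by
  classical
  rw [← prod_sdiff hs, ← sub_one_mul]
  refine Dvd.dvd.mul_right (dvd_prod_sub_one _ _ g fun n hn => ?_) _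
  rw [mem_sdiff, mem_range] at hn
  exact (pow_dvd_pow _ (by omega)).trans (hg n)

theorem Q_pow_dvd_tprod_sub (g : ℕ → MvPowerSeries (Fin (l + 1)) ℤ)
    (hg : ∀ n, Q l ^ (n + 1) ∣ g n - 1) (m : ℕ) :
    Q l ^ m ∣ ∏' n, g n - ∏ n ∈ range m, g n := by
  have h : HasProd g (fun d => coeff d (∏ n ∈ range (d 0 + 1), g n) :
      MvPowerSeries (Fin (l + 1)) ℤ) := by
    refine tendsto_pi_nhds.2 fun d => tendsto_const_nhds.congr' ?_
    rw [SummationFilter.unconditional_filter]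
    filter_upwards [Filter.eventually_ge_atTop (range (d 0 + 1))] with s hs
    exact (coeff_eq_of_Q_pow_dvd_sub (Q_pow_dvd_prod_sub g hg hs) (Nat.lt_succ_self _)).symm
  have hc : ∀ d, coeff d (∏' n, g n) = coeff d (∏ n ∈ range (d 0 + 1), g n) := fun d => by
    rw [h.tprod_eq]
    rfl
  rw [Q_pow_dvd_iff]
  intro d hd
  rw [map_sub, sub_eq_zero, hc, coeff_eq_of_Q_pow_dvd_sub
    (Q_pow_dvd_prod_sub g hg (range_mono (Nat.succ_le_of_lt hd))) (Nat.lt_succ_self _)]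

theorem coeff_tsum {σ ι : Type*} (F : ι → MvPowerSeries σ ℤ)
    (hF : ∀ d, ∃ s : Finset ι, ∀ i ∉ s, coeff d (F i) = 0) (d : σ →₀ ℕ) (s : Finset ι)
    (hs : ∀ i ∉ s, coeff d (F i) = 0) : coeff d (∑' i, F i) = ∑ i ∈ s, coeff d (F i) := by
  choose S hS using hF
  have h : HasSum F (fun d => ∑ i ∈ S d, coeff d (F i) : MvPowerSeries σ ℤ) :=
    Pi.hasSum.2 fun d => hasSum_sum_of_ne_finset_zero (hS d)
  have h' : coeff d (∑' i, F i) = ∑ i ∈ S d, coeff d (F i) := by rw [h.tsum_eq]; rfl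
  have e : HasSum (fun i => coeff d (F i)) (∑ i ∈ S d, coeff d (F i)) :=
    hasSum_sum_of_ne_finset_zero (hS d)
  rw [h']
  exact e.unique (hasSum_sum_of_ne_finset_zero hs)

/-- A lift of `ex N (u q^j)` to power series. -/
noncomputable def exLift (l N : ℕ) (u : MvPowerSeries (Fin (l + 1)) ℤ) (j : ℕ) :
    MvPowerSeries (Fin (l + 1)) ℤ :=
  ∑ k ∈ range N, (-(u * Q l ^ j)) ^ k * Q l ^ k.choose 2 * Ring.inverse (qPoch l k)

theorem toTrunc_exLift (N : ℕ) (u : MvPowerSeries (Fin (l + 1)) ℤ) (j : ℕ) :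
    toTrunc l N (exLift l N u j) = ex N (toTrunc l N u * qz j) := by
  rw [exLift, ex, map_sum]
  refine sum_congr rfl fun k _ => ?_
  rw [map_mul, map_mul, map_pow, map_neg, map_mul, toTrunc_Q_pow, toTrunc_Q_pow,
    toTrunc_inverse_qPoch, tri]

theorem Q_pow_dvd_exLift_sub_one {N : ℕ} (hN : 0 < N) (u : MvPowerSeries (Fin (l + 1)) ℤ)
    (j : ℕ) : Q l ^ j ∣ exLift l N u j - 1 := by
  obtain ⟨M, rfl⟩ : ∃ M, N = M + 1 := ⟨N - 1, by omega⟩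
  rw [exLift, sum_range_succ']
  simp only [pow_zero, Nat.choose_zero_succ, mul_one, qPoch, prod_range_zero, Ring.inverse_one,
    add_sub_cancel_right]
  refine dvd_sum fun k _ => ?_
  exact Dvd.dvd.mul_right (Dvd.dvd.mul_right
    ((dvd_neg.2 (dvd_mul_left _ _)).trans (dvd_pow_self _ (by omega))) _) _

theorem toTrunc_tprod_mul_gi {N : ℕ} (hN : 0 < N) (u : MvPowerSeries (Fin (l + 1)) ℤ)
    (hu : toTrunc l N u ^ N = 0) :
    toTrunc l N (∏' n : ℕ, Ring.inverse (1 - Q l ^ (n + 1) * u)) * gi N (toTrunc l N u) = 1 := by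
  have hinv := fun n => Ring.inverse_mul_cancel _ (isUnit_one_sub_Q_pow_mul l n u)
  have hg := Q_pow_dvd_tprod_sub (fun n => Ring.inverse (1 - Q l ^ (n + 1) * u)) fun n => by
    refine ⟨u * Ring.inverse (1 - Q l ^ (n + 1) * u), ?_⟩
    linear_combination hinv n
  set P := ∏' n : ℕ, Ring.inverse (1 - Q l ^ (n + 1) * u)
  have hgi : gi N (toTrunc l N u) = toTrunc l N (exLift l N u 1) := by
    rw [toTrunc_exLift, gi, Nat.cast_one]
  rw [hgi, ← map_mul, ← sub_eq_zero, ← map_one (toTrunc l N), ← map_sub, toTrunc_eq_zero_iff]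
  intro d hd
  set m := d 0 + 1 with hm
  have he : exLift l N u 1 - (∏ n ∈ range m, (1 - Q l ^ (n + 1) * u)) * exLift l N u (m + 1)
      ∈ vanishingIdeal (yCut l N) := by
    rw [← toTrunc_eq_zero_iff, map_sub, map_mul, toTrunc_exLift, toTrunc_exLift, map_prod,
      ex_eq_pc_mul N (toTrunc l N u * qz (1 : ℕ)) (by rw [mul_pow, hu, zero_mul]) m, sub_eq_zero,
      mul_assoc, ← qz_add, Nat.cast_succ m, Nat.cast_one, add_comm (1 : ℤ), pc]
    congr 1
    refine prod_congr rfl fun n _ => ?_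
    rw [map_sub, map_one, map_mul, toTrunc_Q_pow, mul_assoc, ← qz_add, Nat.cast_succ n,
      add_comm (1 : ℤ), mul_comm]
  have h1 := (vanishingIdeal (yCut l N)).mul_mem_left P he d hd
  have h2 : Q l ^ m ∣ P * (∏ n ∈ range m, (1 - Q l ^ (n + 1) * u)) * exLift l N u (m + 1) - 1 := by
    have h3 : (∏ n ∈ range m, Ring.inverse (1 - Q l ^ (n + 1) * u)) *
        (∏ n ∈ range m, (1 - Q l ^ (n + 1) * u)) = 1 := by
      rw [← prod_mul_distrib]
      exact prod_eq_one fun n _ => hinv n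
    rw [show P * (∏ n ∈ range m, (1 - Q l ^ (n + 1) * u)) * exLift l N u (m + 1) - 1
      = (P - ∏ n ∈ range m, Ring.inverse (1 - Q l ^ (n + 1) * u)) *
        ((∏ n ∈ range m, (1 - Q l ^ (n + 1) * u)) * exLift l N u (m + 1)) +
        (exLift l N u (m + 1) - 1) by linear_combination exLift l N u (m + 1) * h3]
    exact dvd_add ((hg m).mul_right _)
      ((pow_dvd_pow _ (Nat.le_succ m)).trans (Q_pow_dvd_exLift_sub_one hN u (m + 1)))
  have h4 := Q_pow_dvd_iff.1 h2 d (by omega)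
  rw [show P * exLift l N u 1 - 1 = P * (exLift l N u 1 -
    (∏ n ∈ range m, (1 - Q l ^ (n + 1) * u)) * exLift l N u (m + 1)) +
    (P * (∏ n ∈ range m, (1 - Q l ^ (n + 1) * u)) * exLift l N u (m + 1) - 1) by ring,
    map_add, h1, h4, add_zero]

end convergence

/-! ### Comparison of the two sides after truncation -/

section comparison

variable {l : ℕ}

theorem exists_bound_of_isDescending {r : ℕ → ℕ → ℕ} (hr : ∀ i, IsDescending (r i))
    (h0 : ∀ i, i ∉ Icc 1 l → r i = 0) : ∃ T, ∀ i t, T ≤ t → r i t = 0 := by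
  choose B hB using fun i => (hr i).2
  refine ⟨(Icc 1 l).sup B, fun i t ht => ?_⟩
  by_cases hi : i ∈ Icc 1 l
  · exact hB i t ((le_sup hi).trans ht)
  · rw [h0 i hi, Pi.zero_apply]

theorem finprod_inverse_qPoch {T : ℕ} {r : ℕ → ℕ} (hr : ∀ t, T ≤ t → r t = 0) :
    ∏ᶠ j : ℕ, Ring.inverse (qPoch l (r j - r (j + 1))) =
      ∏ j ∈ range T, Ring.inverse (qPoch l (r j - r (j + 1))) := by
  refine finprod_eq_prod_of_mulSupport_subset _ fun j hj => ?_
  rw [coe_range, Set.mem_Iio]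
  by_contra h
  refine hj ?_
  beta_reduce
  rw [hr j (by omega), Nat.zero_sub, qPoch, prod_range_zero, Ring.inverse_one]

/-- The summand attached to a tuple of descending sequences. -/
noncomputable def summand (l : ℕ) (E : (ℕ → ℕ → ℕ) → ℤ) (r : ℕ → ℕ → ℕ) :
    MvPowerSeries (Fin (l + 1)) ℤ :=
  Q l ^ (E r).toNat * (∏ i ∈ Icc 1 l, Y l i ^ (∑ᶠ t : ℕ, r i t)) *
    ∏ i ∈ Icc 1 l, ∏ᶠ j : ℕ, Ring.inverse (qPoch l (r i j - r i (j + 1)))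

theorem summand_mem (E : (ℕ → ℕ → ℕ) → ℤ) {N i : ℕ} {r : ℕ → ℕ → ℕ} (hi : i ∈ Icc 1 l)
    (h : N ≤ ∑ᶠ t : ℕ, r i t) : summand l E r ∈ vanishingIdeal (yCut l N) := by
  refine Ideal.mul_mem_right _ _ (Ideal.mul_mem_left _ _ ?_)
  refine Ideal.mem_of_dvd _ ?_ (Y_pow_mem (N := N) hi)
  exact (pow_dvd_pow _ h).trans (dvd_prod_of_mem (fun i => Y l i ^ (∑ᶠ t : ℕ, r i t)) hi)

theorem lt_finsum_of_notMem_box {T : ℕ} {r : ℕ → ℕ} (hr : IsDescending r) (h : r ∉ box T) :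
    T < ∑ᶠ t : ℕ, r t := by
  obtain ⟨ha, B, hB⟩ := hr
  rw [finsum_eq_sum_range (T := B + T + 1) fun t ht => hB t (by omega)]
  by_cases h0 : r 0 ≤ T
  · have hT : 1 ≤ r T := by
      by_contra hT
      refine h (mem_box.2 ⟨ha, h0, fun t ht => ?_⟩)
      have := ha ht
      omega
    calc T < ∑ _t ∈ range (T + 1), 1 := by simp
      _ ≤ ∑ t ∈ range (T + 1), r t := sum_le_sum fun t ht =>
        hT.trans (ha (Nat.lt_succ_iff.1 (mem_range.1 ht)))
      _ ≤ _ := sum_le_sum_of_subset (range_mono (by omega))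
  · calc T < r 0 := by omega
      _ ≤ _ := single_le_sum (f := r) (fun _ _ => Nat.zero_le _) (mem_range.2 (by omega))

theorem summand_mem_of_notMem_tuples (E : (ℕ → ℕ → ℕ) → ℤ) {N T : ℕ} (hT : N ≤ T)
    {r : ℕ → ℕ → ℕ} (hr : ∀ i, IsDescending (r i)) (h0 : ∀ i, i ∉ Icc 1 l → r i = 0)
    (h : r ∉ tuples T 1 l) : summand l E r ∈ vanishingIdeal (yCut l N) := by
  obtain ⟨i, hi, hb⟩ : ∃ i ∈ Icc 1 l, r i ∉ box T := by
    by_contra! hc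
    refine h (mem_tuples.2 ⟨fun j h1 h2 => hc j (mem_Icc.2 ⟨h1, by omega⟩), fun j hj =>
      h0 j fun hm => hj ?_⟩)
    rw [mem_Icc] at hm
    omega
  exact summand_mem E hi (hT.trans (lt_finsum_of_notMem_box (hr i) hb).le)

theorem isDescending_of_mem_tuples {T : ℕ} {r : ℕ → ℕ → ℕ} (h : r ∈ tuples T 1 l) :
    (∀ i, IsDescending (r i)) ∧ ∀ i, i ∉ Icc 1 l → r i = 0 := by
  obtain ⟨h1, h2⟩ := mem_tuples.1 h
  have h3 : ∀ i, i ∉ Icc 1 l → r i = 0 := fun i hi => h2 i fun hc => hi (mem_Icc.2 (by omega))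
  refine ⟨fun i => ?_, h3⟩
  by_cases hi : i ∈ Icc 1 l
  · rw [mem_Icc] at hi
    obtain ⟨ha, -, hT⟩ := mem_box.1 (h1 i hi.1 (by omega))
    exact ⟨ha, T, hT⟩
  · rw [h3 i hi]
    exact ⟨antitone_const, 0, fun _ _ => rfl⟩

theorem eq_zero_of_mem_tuples {T i t : ℕ} {r : ℕ → ℕ → ℕ} (h : r ∈ tuples T 1 l) (ht : T ≤ t) :
    r i t = 0 := by
  obtain ⟨h1, h2⟩ := mem_tuples.1 h
  by_cases hi : 1 ≤ i ∧ i < 1 + l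
  · exact (mem_box.1 (h1 i hi.1 hi.2)).2.2 t ht
  · rw [h2 i hi, Pi.zero_apply]

theorem toTrunc_tsum_summand (E : (ℕ → ℕ → ℕ) → ℤ) {N T : ℕ} (hT : N ≤ T) :
    toTrunc l N (∑' r : {r : ℕ → ℕ → ℕ //
        (∀ i, IsDescending (r i)) ∧ ∀ i, i ∉ Icc 1 l → r i = 0}, summand l E r.1) =
      ∑ r ∈ tuples T 1 l, toTrunc l N (summand l E r) := by
  classical
  rw [← map_sum, ← sub_eq_zero, ← map_sub, toTrunc_eq_zero_iff]
  intro d hd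
  have key : ∀ M S : ℕ, M ≤ S → ∀ d ∈ yCut l M, ∀ r : {r : ℕ → ℕ → ℕ //
      (∀ i, IsDescending (r i)) ∧ ∀ i, i ∉ Icc 1 l → r i = 0},
      r ∉ (tuples S 1 l).subtype _ → coeff d (summand l E r.1) = 0 := fun M S hM d hd r hr =>
    summand_mem_of_notMem_tuples E hM r.2.1 r.2.2 (fun h => hr (mem_subtype.2 h)) d hd
  rw [map_sub, coeff_tsum _ (fun d => ?_) d _ (key N T hT d hd),
    sum_subtype_of_mem (fun r => coeff d (summand l E r))
      (fun r hr => isDescending_of_mem_tuples hr), map_sum, sub_self]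
  obtain ⟨M, -, hM⟩ := exists_mem_yCut d
  exact ⟨_, key M M le_rfl d hM⟩

theorem toTrunc_summand {E : (ℕ → ℕ → ℕ) → ℤ} {N T n : ℕ} {r : ℕ → ℕ → ℕ}
    (h : r ∈ tuples T 1 l) (hE : E r = energy T n r) :
    toTrunc l N (summand l E r) =
      ((QBase.q : (LaurentTrunc l N)ˣ) : LaurentTrunc l N) ^ (energy T n r).toNat *
        (∏ i ∈ Icc 1 l, toTrunc l N (Y l i) ^ ∑ t ∈ range T, r i t) *
        ∏ i ∈ Icc 1 l, ∏ t ∈ range T, iq (r i t - r i (t + 1)) := by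
  rw [summand, map_mul, map_mul, map_pow, toTrunc_Q, hE, map_prod, map_prod]
  congr 1
  · congr 1
    refine prod_congr rfl fun i _ => ?_
    rw [map_pow, finsum_eq_sum_range fun t ht => eq_zero_of_mem_tuples h ht]
  · refine prod_congr rfl fun i _ => ?_
    rw [finprod_inverse_qPoch fun t ht => eq_zero_of_mem_tuples h ht, map_prod]
    exact prod_congr rfl fun t _ => toTrunc_inverse_qPoch l N _

theorem toTrunc_monomial_pow {N s : ℕ} (c : ℕ → ℕ) (hs : s ∈ Icc 1 l) (hc : c s ≠ 0) :
    toTrunc l N (∏ s ∈ Icc 1 l, Y l s ^ c s) ^ N = 0 := by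
  rw [← map_pow, toTrunc_eq_zero_iff]
  refine Ideal.mem_of_dvd _ (pow_dvd_pow_of_dvd ?_ N) (Y_pow_mem hs)
  exact (dvd_pow_self _ hc).trans (dvd_prod_of_mem (fun s => Y l s ^ c s) hs)

theorem eq_of_toTrunc_eq {a b : MvPowerSeries (Fin (l + 1)) ℤ}
    (h : ∀ N, 0 < N → toTrunc l N a = toTrunc l N b) : a = b := by
  ext d
  obtain ⟨N, hN, hd⟩ := exists_mem_yCut d
  have := h N hN
  rw [← sub_eq_zero, ← map_sub, toTrunc_eq_zero_iff] at this
  have := this d hd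
  rwa [map_sub, sub_eq_zero] at this

end comparison

end QSeries

/-- The identity of Theorem 7.3 in type `C_l` (`l ≥ 2`), in the paper's
labeling where `α₁` is the long simple root.  Positive roots (vectors `c : ℕ → ℕ`
supported on `1 ≤ s ≤ l`): the long roots `α₁` and `α₁ + 2(α₂ + ⋯ + α_m)` for
`2 ≤ m ≤ l`; the short roots `αᵢ + ⋯ + α_j` for `2 ≤ i ≤ j ≤ l`; the short roots
`α₁ + α₂ + ⋯ + α_b` for `2 ≤ b ≤ l`; and the short roots
`α₁ + 2(α₂ + ⋯ + α_a) + α_{a+1} + ⋯ + α_b` for `2 ≤ a < b ≤ l`.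
Then in `ℤ[[q, y₁, …, y_l]]`:
`∏_{c ∈ Φ⁺} ∏_{n ≥ 1} (1 - qⁿ y^c)⁻¹
  = ∑_{(r₁,…,r_l) descending} q^{E r} (∏ᵢ yᵢ^{|rᵢ|}) ∏ᵢ ∏_{j ≥ 1} (q;q)_{rᵢ^{(j)}-rᵢ^{(j+1)}}⁻¹`,
with `E r = ∑_{i=1}^{l} ∑_{t≥1} (rᵢ^{(t)})² - ∑_{t≥1} r₁^{(t)} (r₂^{(2t-1)} + r₂^{(2t)})
 - ∑_{i=3}^{l} ∑_{t≥1} r_{i-1}^{(t)} rᵢ^{(t)}`, a nonnegative integer. -/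
theorem stmt_7 (l : ℕ) (hl : 2 ≤ l)
    (Φ : Finset (ℕ → ℕ))
    (hΦ : ∀ c : ℕ → ℕ, c ∈ Φ ↔
      ((c = fun s => if s = 1 then 1 else 0)
        ∨ (∃ m, 2 ≤ m ∧ m ≤ l ∧
          c = fun s => (if s = 1 then 1 else 0) + (if 2 ≤ s ∧ s ≤ m then 2 else 0))
        ∨ (∃ i j, 2 ≤ i ∧ i ≤ j ∧ j ≤ l ∧
          c = fun s => if i ≤ s ∧ s ≤ j then 1 else 0)
        ∨ (∃ b, 2 ≤ b ∧ b ≤ l ∧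
          c = fun s => if 1 ≤ s ∧ s ≤ b then 1 else 0)
        ∨ (∃ a b, 2 ≤ a ∧ a < b ∧ b ≤ l ∧
          c = fun s => (if s = 1 then 1 else 0) + (if 2 ≤ s ∧ s ≤ a then 2 else 0)
            + (if a + 1 ≤ s ∧ s ≤ b then 1 else 0))))
    (E : (ℕ → ℕ → ℕ) → ℤ)
    (hE : ∀ r : ℕ → ℕ → ℕ, E r =
      (∑ i ∈ Finset.Icc 1 l, ∑ᶠ t : ℕ, (r i t : ℤ) ^ 2)
        - (∑ᶠ t : ℕ, (r 1 t : ℤ) * ((r 2 (2 * t) : ℤ) + (r 2 (2 * t + 1) : ℤ)))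
        - ∑ i ∈ Finset.Icc 3 l, ∑ᶠ t : ℕ, (r (i - 1) t : ℤ) * (r i t : ℤ)) :
    (∀ r : ℕ → ℕ → ℕ,
        (∀ i, IsDescending (r i)) → (∀ i, i ∉ Finset.Icc 1 l → r i = 0) → 0 ≤ E r)
    ∧ (∏ c ∈ Φ, ∏' n : ℕ,
          Ring.inverse (1 - Q l ^ (n + 1) * ∏ s ∈ Finset.Icc 1 l, Y l s ^ c s))
      = ∑' r : {r : ℕ → ℕ → ℕ //
            (∀ i, IsDescending (r i)) ∧ ∀ i, i ∉ Finset.Icc 1 l → r i = 0},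
          Q l ^ (E r.1).toNat
            * (∏ i ∈ Finset.Icc 1 l, Y l i ^ (∑ᶠ t : ℕ, r.1 i t))
            * ∏ i ∈ Finset.Icc 1 l, ∏ᶠ j : ℕ,
                Ring.inverse (qPoch l (r.1 i j - r.1 i (j + 1))) := by
  obtain ⟨n, rfl⟩ : ∃ n, l = n + 1 := ⟨l - 1, by omega⟩
  have hn : 1 ≤ n := by omega
  have hen : ∀ T r, (∀ i t, T ≤ t → r i t = 0) → E r = QSeries.energy T n r := fun T r hr =>
    (hE r).trans (QSeries.energy_eq hn rfl r hr)
  refine ⟨fun r hr h0 => ?_, QSeries.eq_of_toTrunc_eq fun N hN => ?_⟩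
  · obtain ⟨T, hT⟩ := QSeries.exists_bound_of_isDescending hr h0
    rw [hen T r hT]
    exact QSeries.energy_nonneg T hn r
  have hmain := QSeries.prod_gi_mul_sum_tuples hN le_rfl hn rfl
    (fun s => QSeries.toTrunc (n + 1) N (Y (n + 1) s)) (fun i hi => by
      rw [← map_pow, QSeries.toTrunc_eq_zero_iff]
      exact QSeries.Y_pow_mem hi) Φ hΦ
  have hsum := QSeries.toTrunc_tsum_summand (l := n + 1) E (N := N) (T := 4 * N) (by omega)
  rw [Finset.sum_congr rfl fun r hr => QSeries.toTrunc_summand hr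
    (hen _ r fun i t ht => QSeries.eq_zero_of_mem_tuples hr ht)] at hsum
  rw [← hsum] at hmain
  refine left_inv_eq_right_inv ?_ hmain
  rw [map_prod, ← Finset.prod_mul_distrib]
  refine Finset.prod_eq_one fun c hc => ?_
  obtain ⟨s, hs, hcs⟩ : ∃ s ∈ Finset.Icc 1 (n + 1), c s ≠ 0 := by
    rcases (hΦ c).1 hc with rfl | ⟨m, -, -, rfl⟩ | ⟨i, j, hi, hij, hj, rfl⟩ | ⟨b, hb, -, rfl⟩ |
      ⟨a, b, -, -, -, rfl⟩
    · exact ⟨1, by simp⟩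
    · exact ⟨1, by simp⟩
    · exact ⟨i, Finset.mem_Icc.2 (by omega), by simp [hij]⟩
    · exact ⟨1, by simp, by simp; omega⟩
    · exact ⟨1, by simp⟩
  have := QSeries.toTrunc_tprod_mul_gi hN _ (QSeries.toTrunc_monomial_pow (N := N) c hs hcs)
  rwa [map_prod, Finset.prod_congr rfl fun s _ => map_pow _ _ _] at this
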